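/- arXiv:2201.05521 — 3 statements merged into one kernel-verified Lean document; each statement's English description precedes it below -/
import Mathlib

section
/- Let Ω be a bounded regular domain in ℝ^d with torsion function T_0 (i.e. T_0 ∈ C(closure of Ω) ∩ C^2(Ω), T_0 = 0 on ∂Ω, ΔT_0 = -1 on Ω). Let f ∈ C(closure of Ω) ∩ C^2(Ω) vanish on ∂Ω and suppose Δf is bounded on Ω. Then for every p > 1, with q the conjugate exponent (1/p + 1/q = 1), one has ‖f‖_{L^p(Ω)} ≤ (sup_{x ∈ Ω} T_0(x))^{(p+q)/(pq)} · ‖Δf‖_{L^p(Ω)}. -/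
open MeasureTheory Metric Set Filter Topology

noncomputable section

/-- The Laplace operator `Δf = ∑ ∂²f/∂xᵢ²` on `ℝᵈ`. -/
def laplacian {d : ℕ} {V : Type*} [NormedAddCommGroup V] [NormedSpace ℝ V]
    (f : EuclideanSpace ℝ (Fin d) → V) (x : EuclideanSpace ℝ (Fin d)) : V :=
  ∑ i : Fin d, iteratedFDeriv ℝ 2 f x ![EuclideanSpace.single i 1, EuclideanSpace.single i 1]

/-- A function is harmonic on an open set `U` if it is `C²` there and `Δf = 0` on `U`. -/
def HarmonicOn {d : ℕ} (f : EuclideanSpace ℝ (Fin d) → ℝ)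
    (U : Set (EuclideanSpace ℝ (Fin d))) : Prop :=
  ContDiffOn ℝ 2 f U ∧ ∀ x ∈ U, laplacian f x = 0

/-- The Dirichlet problem is solvable for `U`: every continuous function on `∂U`
extends to a function continuous on the closure of `U` and harmonic in `U`. -/
def DirichletSolvable (d : ℕ) (U : Set (EuclideanSpace ℝ (Fin d))) : Prop :=
  ∀ g : EuclideanSpace ℝ (Fin d) → ℝ, ContinuousOn g (frontier U) →
    ∃ h : EuclideanSpace ℝ (Fin d) → ℝ,
      ContinuousOn h (closure U) ∧ HarmonicOn h U ∧ ∀ x ∈ frontier U, h x = g x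

/-- The integral over an open set of a directional derivative of a `C¹` function which vanishes
outside of a compact subset is zero. -/
lemma integrableOn_fderiv_and_integral_eq_zero {d : ℕ} {Ω K : Set (EuclideanSpace ℝ (Fin d))}
    (hΩ : IsOpen Ω) (hK : IsCompact K) (hKΩ : K ⊆ Ω) {w : EuclideanSpace ℝ (Fin d) → ℝ}
    (hw : ContDiffOn ℝ 1 w Ω) (hw0 : ∀ x ∈ Ω, x ∉ K → w x = 0) (e : EuclideanSpace ℝ (Fin d)) :
    IntegrableOn (fun x ↦ fderiv ℝ w x e) Ω ∧ ∫ x in Ω, fderiv ℝ w x e = 0 := by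
  set v := Ω.indicator w with hv
  have hvK : ∀ x ∉ K, v x = 0 := fun x hx ↦ by
    by_cases h : x ∈ Ω
    · rw [hv, indicator_of_mem h, hw0 x h hx]
    · rw [hv, indicator_of_notMem h]
  have hvw : ∀ x ∈ Ω, v =ᶠ[𝓝 x] w := fun x hx ↦ by
    filter_upwards [hΩ.mem_nhds hx] with y hy using indicator_of_mem hy w
  have hv0 : ∀ x ∉ K, v =ᶠ[𝓝 x] fun _ ↦ 0 := fun x hx ↦ by
    filter_upwards [hK.isClosed.isOpen_compl.mem_nhds hx] with y hy using hvK y hy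
  have hvc : ContDiff ℝ 1 v := contDiff_iff_contDiffAt.2 fun x ↦ by
    by_cases h : x ∈ K
    · exact ((hw x (hKΩ h)).contDiffAt (hΩ.mem_nhds (hKΩ h))).congr_of_eventuallyEq
        (hvw x (hKΩ h))
    · exact contDiffAt_const.congr_of_eventuallyEq (hv0 x h)
  have hsupp : HasCompactSupport v := HasCompactSupport.intro hK hvK
  have hcont : Continuous fun x ↦ fderiv ℝ v x e :=
    (hvc.continuous_fderiv one_ne_zero).clm_apply continuous_const
  have hint : Integrable fun x ↦ fderiv ℝ v x e :=
    hcont.integrable_of_hasCompactSupport (hsupp.fderiv_apply ℝ e)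
  have hind : (fun x ↦ fderiv ℝ v x e) = Ω.indicator fun x ↦ fderiv ℝ w x e := by
    ext x
    by_cases h : x ∈ Ω
    · rw [indicator_of_mem h, (hvw x h).fderiv_eq]
    · rw [indicator_of_notMem h, (hv0 x fun hx ↦ h (hKΩ hx)).fderiv_eq]
      simp
  refine ⟨(integrable_indicator_iff hΩ.measurableSet).1 (hind ▸ hint), ?_⟩
  rw [← integral_indicator hΩ.measurableSet, ← hind]
  have h := integral_mul_fderiv_eq_neg_fderiv_mul_of_integrable (μ := volume) (f := v)
    (g := fun _ ↦ (1 : ℝ)) (v := e) (by simpa using hint) (by simp)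
    (by simpa using hvc.continuous.integrable_of_hasCompactSupport hsupp)
    (fun x _ ↦ (hvc.differentiable one_ne_zero) x) (fun x _ ↦ differentiableAt_const _)
  simpa using h.symm

lemma laplacian_eq_sum_fderiv_fderiv {d : ℕ} (f : EuclideanSpace ℝ (Fin d) → ℝ)
    (x : EuclideanSpace ℝ (Fin d)) :
    laplacian f x = ∑ i, fderiv ℝ (fderiv ℝ f) x (EuclideanSpace.single i 1)
      (EuclideanSpace.single i 1) := by
  simp [laplacian, iteratedFDeriv_two_apply]

lemma ContDiffOn.contDiffOn_fderiv_apply {d : ℕ} {Ω : Set (EuclideanSpace ℝ (Fin d))}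
    (hΩ : IsOpen Ω) {f : EuclideanSpace ℝ (Fin d) → ℝ} (hf : ContDiffOn ℝ 2 f Ω)
    (e : EuclideanSpace ℝ (Fin d)) : ContDiffOn ℝ 1 (fun x ↦ fderiv ℝ f x e) Ω :=
  (hf.fderiv_of_isOpen hΩ (by norm_num)).clm_apply contDiffOn_const

lemma continuousOn_laplacian {d : ℕ} {Ω : Set (EuclideanSpace ℝ (Fin d))}
    (hΩ : IsOpen Ω) {f : EuclideanSpace ℝ (Fin d) → ℝ} (hf : ContDiffOn ℝ 2 f Ω) :
    ContinuousOn (laplacian f) Ω := by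
  have h1 : ContDiffOn ℝ 1 (fderiv ℝ f) Ω := hf.fderiv_of_isOpen hΩ (by norm_num)
  have h2 : ContinuousOn (fderiv ℝ (fderiv ℝ f)) Ω :=
    h1.continuousOn_fderiv_of_isOpen hΩ le_rfl
  rw [funext (laplacian_eq_sum_fderiv_fderiv f)]
  exact continuousOn_finsetSum _ fun i _ ↦
    (h2.clm_apply continuousOn_const).clm_apply continuousOn_const

lemma hasLineDerivAt_of_contDiffOn {d : ℕ} {Ω : Set (EuclideanSpace ℝ (Fin d))}
    (hΩ : IsOpen Ω) {f : EuclideanSpace ℝ (Fin d) → ℝ} (hf : ContDiffOn ℝ 2 f Ω)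
    {x : EuclideanSpace ℝ (Fin d)} (hx : x ∈ Ω) (e : EuclideanSpace ℝ (Fin d)) :
    HasLineDerivAt ℝ f (fderiv ℝ f x e) x e ∧
      HasLineDerivAt ℝ (fun y ↦ fderiv ℝ f y e) (fderiv ℝ (fderiv ℝ f) x e e) x e := by
  have h1 : ContDiffOn ℝ 1 (fderiv ℝ f) Ω := hf.fderiv_of_isOpen hΩ (by norm_num)
  have d0 : DifferentiableAt ℝ f x :=
    ((hf x hx).contDiffAt (hΩ.mem_nhds hx)).differentiableAt two_ne_zero
  have d1 : DifferentiableAt ℝ (fderiv ℝ f) x :=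
    ((h1 x hx).contDiffAt (hΩ.mem_nhds hx)).differentiableAt one_ne_zero
  refine ⟨d0.hasFDerivAt.hasLineDerivAt e, ?_⟩
  have := (d1.hasFDerivAt.clm_apply (hasFDerivAt_const e x)).hasLineDerivAt e
  simpa using this

lemma IsLocalMin.fderiv_fderiv_nonneg {d : ℕ} {Ω : Set (EuclideanSpace ℝ (Fin d))}
    (hΩ : IsOpen Ω) {f : EuclideanSpace ℝ (Fin d) → ℝ} (hf : ContDiffOn ℝ 2 f Ω)
    {x : EuclideanSpace ℝ (Fin d)} (hx : x ∈ Ω) (hmin : IsLocalMin f x)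
    (e : EuclideanSpace ℝ (Fin d)) : 0 ≤ fderiv ℝ (fderiv ℝ f) x e e := by
  by_contra! hneg
  set φ : ℝ → ℝ := fun t ↦ f (x + t • e) with hφ
  have hline : Continuous fun t : ℝ ↦ x + t • e := by fun_prop
  have hmem : ∀ᶠ t : ℝ in 𝓝 0, x + t • e ∈ Ω :=
    hline.continuousAt.eventually (by simpa using hΩ.mem_nhds hx)
  have hderiv : deriv φ =ᶠ[𝓝 0] fun t ↦ fderiv ℝ f (x + t • e) e := by
    filter_upwards [hmem] with t ht
    have h := (hasLineDerivAt_of_contDiffOn hΩ hf ht e).1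
    have h2 : HasDerivAt (fun s : ℝ ↦ f (x + t • e + s • e)) (fderiv ℝ f (x + t • e) e) (t - t) := by
      rw [sub_self]; exact h
    have h3 := h2.comp_sub_const t t
    refine (h3.congr_of_eventuallyEq (Eventually.of_forall fun s ↦ ?_)).deriv
    simp only [hφ]
    congr 1
    rw [add_assoc, ← add_smul]
    congr 2
    ring
  have hdd : deriv (deriv φ) 0 = fderiv ℝ (fderiv ℝ f) x e e := by
    rw [hderiv.deriv_eq]
    exact HasDerivAt.deriv (hasLineDerivAt_of_contDiffOn hΩ hf hx e).2
  have hφmin : IsLocalMin φ 0 := by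
    have : Tendsto (fun t : ℝ ↦ x + t • e) (𝓝 0) (𝓝 x) := by
      simpa using hline.tendsto 0
    filter_upwards [this.eventually hmin] with t ht
    simpa [hφ] using ht
  have hc : ContinuousAt φ 0 := by
    have := (hasLineDerivAt_of_contDiffOn hΩ hf hx e).1
    exact HasDerivAt.continuousAt this
  have hmax : IsLocalMax φ 0 :=
    isLocalMax_of_deriv_deriv_neg (hdd ▸ hneg) hφmin.deriv_eq_zero hc
  have hconst : φ =ᶠ[𝓝 0] fun _ ↦ φ 0 := by
    filter_upwards [hφmin, hmax] with t h1 h2 using le_antisymm h2 h1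
  have h0 : deriv φ =ᶠ[𝓝 0] fun _ ↦ 0 := by
    filter_upwards [hconst.eventuallyEq_nhds] with t ht
    rw [ht.deriv_eq, deriv_const]
  rw [← hdd, h0.deriv_eq, deriv_const] at hneg
  exact lt_irrefl _ hneg

/-- A function with negative Laplacian in a bounded open set and vanishing boundary values is
positive. -/
lemma pos_of_laplacian_neg {d : ℕ} {Ω : Set (EuclideanSpace ℝ (Fin d))}
    (hΩ : IsOpen Ω) (hbdd : Bornology.IsBounded Ω) {u : EuclideanSpace ℝ (Fin d) → ℝ}
    (hc : ContinuousOn u (closure Ω)) (hu : ContDiffOn ℝ 2 u Ω) (hb : ∀ x ∈ frontier Ω, u x = 0)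
    (hlap : ∀ x ∈ Ω, laplacian u x < 0) {x : EuclideanSpace ℝ (Fin d)} (hx : x ∈ Ω) :
    0 < u x := by
  obtain ⟨y, hy, hmin⟩ := hbdd.isCompact_closure.exists_isMinOn ⟨x, subset_closure hx⟩ hc
  have key : ∀ z ∈ Ω, ¬ IsMinOn u (closure Ω) z := fun z hz hzmin ↦ by
    have hloc : IsLocalMin u z :=
      hzmin.isLocalMin (mem_of_superset (hΩ.mem_nhds hz) subset_closure)
    have h1 := hlap z hz
    rw [laplacian_eq_sum_fderiv_fderiv] at h1
    exact h1.not_ge (Finset.sum_nonneg fun i _ ↦ hloc.fderiv_fderiv_nonneg hΩ hu hz _)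
  have hyΩ : y ∉ Ω := fun h ↦ key y h hmin
  have hy0 : u y = 0 := hb y ⟨hy, fun h ↦ hyΩ (hΩ.interior_eq ▸ h)⟩
  by_contra! hle
  refine key x hx fun z hz ↦ ?_
  have := hmin hz
  simp only [mem_ofPred_eq] at this ⊢
  linarith

lemma exists_convex_cutoff {ε : ℝ} (hε : 0 < ε) :
    ∃ η η₁ η₂ : ℝ → ℝ, (∀ t, HasDerivAt η (η₁ t) t) ∧ (∀ t, HasDerivAt η₁ (η₂ t) t) ∧
      ContDiff ℝ 1 η ∧ ContDiff ℝ 1 η₁ ∧ (∀ t < ε, 0 ≤ t → η t = 0) ∧ (∀ t < ε, η₁ t = 0) ∧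
      (∀ t, 0 ≤ η₁ t) ∧ (∀ t, η₁ t ≤ 1) ∧ (∀ t, 2 * ε < t → η₁ t = 1) ∧
      (∀ t, 0 ≤ η₂ t) ∧ (∀ t, 2 * ε < t → η₂ t = 0) ∧ (∀ t, 0 ≤ t → 0 ≤ η t) ∧
      ∀ t, 0 ≤ t → η t ≤ t := by
  set η₁ : ℝ → ℝ := fun t ↦ Real.smoothTransition ((t - ε) / ε) with hη₁
  have hsm : ContDiff ℝ 1 η₁ :=
    (Real.smoothTransition.contDiff (n := 1)).comp ((contDiff_id.sub contDiff_const).div_const ε)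
  have hmono : Monotone η₁ := fun a b hab ↦ Real.smoothTransition.monotone (by gcongr)
  have hone : ∀ t, 2 * ε < t → η₁ t = 1 := fun t ht ↦
    Real.smoothTransition.one_of_one_le (by rw [le_div_iff₀ hε]; linarith)
  have hzero : ∀ t < ε, η₁ t = 0 := fun t ht ↦
    Real.smoothTransition.zero_of_nonpos (div_nonpos_of_nonpos_of_nonneg (by linarith) hε.le)
  have hder : ∀ t, HasDerivAt (fun t ↦ ∫ s in (0 : ℝ)..t, η₁ s) (η₁ t) t := fun t ↦
    (hsm.continuous.integral_hasStrictDerivAt 0 t).hasDerivAt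
  refine ⟨fun t ↦ ∫ s in (0 : ℝ)..t, η₁ s, η₁, deriv η₁, hder,
    fun t ↦ ((hsm.differentiable one_ne_zero) t).hasDerivAt, ?_, hsm, ?_, hzero,
    fun t ↦ Real.smoothTransition.nonneg _, fun t ↦ Real.smoothTransition.le_one _, hone,
    fun t ↦ hmono.deriv_nonneg, ?_, ?_, ?_⟩
  · refine contDiff_one_iff_deriv.2 ⟨fun t ↦ (hder t).differentiableAt, ?_⟩
    rw [funext fun t ↦ (hder t).deriv]
    exact hsm.continuous
  · intro t ht h0
    refine intervalIntegral.integral_zero_ae (Eventually.of_forall fun s hs ↦ ?_)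
    rw [uIoc_of_le h0] at hs
    exact hzero s (hs.2.trans_lt ht)
  · intro t ht
    have : η₁ =ᶠ[𝓝 t] fun _ ↦ 1 := by
      filter_upwards [lt_mem_nhds ht] with s hs using hone s hs
    rw [this.deriv_eq, deriv_const]
  · exact fun t ht ↦ intervalIntegral.integral_nonneg ht
      fun s _ ↦ Real.smoothTransition.nonneg _
  · intro t ht
    calc ∫ s in (0 : ℝ)..t, η₁ s ≤ ∫ _s in (0 : ℝ)..t, (1 : ℝ) :=
          intervalIntegral.integral_mono_on ht (hsm.continuous.intervalIntegrable _ _)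
            (by simp) fun s _ ↦ Real.smoothTransition.le_one _
      _ = t := by simp

lemma hasDerivAt_perspective_flux {F T F₁ T₁ ψ ψ₁ η η₁ : ℝ → ℝ} {t f₂ t₂ ψ₂ η₂ : ℝ} (c : ℝ)
    (hT : T t ≠ 0)
    (hF : HasDerivAt F (F₁ t) t) (hT₁ : HasDerivAt T (T₁ t) t)
    (hF₂ : HasDerivAt F₁ f₂ t) (hT₂ : HasDerivAt T₁ t₂ t)
    (hψ : HasDerivAt ψ (ψ₁ (F t / T t)) (F t / T t)) (hψ₁ : HasDerivAt ψ₁ ψ₂ (F t / T t))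
    (hη : HasDerivAt η (η₁ (T t)) (T t)) (hη₁ : HasDerivAt η₁ η₂ (T t)) :
    HasDerivAt (fun s ↦ η (T s) * (ψ₁ (F s / T s) * F₁ s +
        (ψ (F s / T s) - F s / T s * ψ₁ (F s / T s)) * T₁ s) +
        (c - T s * ψ (F s / T s)) * η₁ (T s) * T₁ s)
      (η (T t) * (ψ₁ (F t / T t) * f₂ + (ψ (F t / T t) - F t / T t * ψ₁ (F t / T t)) * t₂ +
        ψ₂ * T t * ((F₁ t - F t / T t * T₁ t) / T t) ^ 2) +
        (c - T t * ψ (F t / T t)) * η₂ * T₁ t ^ 2 +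
        (c - T t * ψ (F t / T t)) * η₁ (T t) * t₂) t := by
  have hr := hF.div hT₁ hT
  have hψr := HasDerivAt.comp t (h₂ := ψ) (h := F / T) hψ hr
  have hψ₁r := HasDerivAt.comp t (h₂ := ψ₁) (h := F / T) hψ₁ hr
  have hηT := hη.comp t hT₁
  have hη₁T := hη₁.comp t hT₁
  have h := (hηT.mul ((hψ₁r.mul hF₂).add ((hψr.sub (hr.mul hψ₁r)).mul hT₂))).add
    ((((hT₁.mul hψr).const_sub c).mul hη₁T).mul hT₂)
  refine h.congr_deriv ?_
  simp only [Function.comp_apply, Pi.mul_apply, Pi.div_apply, Pi.add_apply, Pi.sub_apply]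
  field_simp
  ring

lemma integrableOn_of_continuousOn_of_abs_le {d : ℕ} {Ω : Set (EuclideanSpace ℝ (Fin d))}
    (hΩ : IsOpen Ω) (hbdd : Bornology.IsBounded Ω) {g : EuclideanSpace ℝ (Fin d) → ℝ}
    (hg : ContinuousOn g Ω) {C : ℝ} (hC : ∀ x ∈ Ω, |g x| ≤ C) : IntegrableOn g Ω :=
  IntegrableOn.of_bound hbdd.measure_lt_top (hg.aestronglyMeasurable hΩ.measurableSet) C
    ((ae_restrict_iff' hΩ.measurableSet).2 (Eventually.of_forall hC))

lemma ConvexOn.add_deriv_mul_sub_le {ψ : ℝ → ℝ} (hψ : ConvexOn ℝ univ ψ)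
    (hd : Differentiable ℝ ψ) (r s : ℝ) : ψ r + deriv ψ r * (s - r) ≤ ψ s := by
  rcases lt_trichotomy r s with h | rfl | h
  · have := hψ.deriv_le_slope (mem_univ r) (mem_univ s) h (hd r)
    rw [slope_def_field, le_div_iff₀ (by linarith)] at this
    linarith
  · simp
  · have := hψ.slope_le_deriv (mem_univ s) (mem_univ r) h (hd r)
    rw [slope_def_field, div_le_iff₀ (by linarith)] at this
    linarith

lemma ConvexOn.deriv_deriv_nonneg {ψ : ℝ → ℝ} (hψ : ConvexOn ℝ univ ψ)
    (hd : Differentiable ℝ ψ) (r : ℝ) : 0 ≤ deriv (deriv ψ) r := by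
  have hmono : Monotone (deriv ψ) := by
    have := hψ.monotoneOn_deriv fun x _ ↦ hd x
    exact monotoneOn_univ.1 this
  exact hmono.deriv_nonneg

/-- If `T` is the torsion function of `Ω` and `f` vanishes on the boundary, then the integral of
the perspective `T ψ(f / T)` of a convex function `ψ` is at most that of `T ψ(-Δf)`. -/
lemma integral_perspective_le {d : ℕ} {Ω : Set (EuclideanSpace ℝ (Fin d))}
    (hΩ : IsOpen Ω) (hbdd : Bornology.IsBounded Ω) {T f : EuclideanSpace ℝ (Fin d) → ℝ}
    (hTc : ContinuousOn T (closure Ω)) (hT : ContDiffOn ℝ 2 T Ω)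
    (hTb : ∀ x ∈ frontier Ω, T x = 0) (hTl : ∀ x ∈ Ω, laplacian T x = -1)
    (hTpos : ∀ x ∈ Ω, 0 < T x) {S : ℝ} (hTS : ∀ x ∈ Ω, T x ≤ S)
    (hf : ContDiffOn ℝ 2 f Ω) {M : ℝ}
    (hfT : ∀ x ∈ Ω, |f x| ≤ M * T x) (hfl : ∀ x ∈ Ω, |laplacian f x| ≤ M)
    {ψ : ℝ → ℝ} (hψ : ContDiff ℝ 2 ψ) (hconv : ConvexOn ℝ univ ψ) (hψ0 : ∀ r, 0 ≤ ψ r) :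
    IntegrableOn (fun x ↦ T x * ψ (f x / T x)) Ω ∧
    IntegrableOn (fun x ↦ T x * ψ (-laplacian f x)) Ω ∧
    ∫ x in Ω, T x * ψ (f x / T x) ≤ ∫ x in Ω, T x * ψ (-laplacian f x) := by
  obtain ⟨C, hC⟩ := (isCompact_Icc (a := -M) (b := M)).exists_bound_of_continuousOn
    hψ.continuous.continuousOn
  have hC : ∀ r, |r| ≤ M → ψ r ≤ C := fun r hr ↦ (le_abs_self _).trans (hC r (abs_le.1 hr))
  have hψd : Differentiable ℝ ψ := hψ.differentiable two_ne_zero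
  have hψ₁ : ContDiff ℝ 1 (deriv ψ) := by
    have : ContDiff ℝ (1 + 1) ψ := by simpa [one_add_one_eq_two] using hψ
    exact (contDiff_succ_iff_deriv.1 this).2.2
  have hr : ∀ x ∈ Ω, |f x / T x| ≤ M := fun x hx ↦ by
    rw [abs_div, abs_of_pos (hTpos x hx), div_le_iff₀ (hTpos x hx)]
    exact hfT x hx
  have hhC : ∀ x ∈ Ω, T x * ψ (f x / T x) ≤ C * T x := fun x hx ↦ by
    rw [mul_comm C]
    exact mul_le_mul_of_nonneg_left (hC _ (hr x hx)) (hTpos x hx).le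
  have hTne : ∀ x ∈ Ω, T x ≠ 0 := fun x hx ↦ (hTpos x hx).ne'
  have hbound : ∀ g : EuclideanSpace ℝ (Fin d) → ℝ, (∀ x ∈ Ω, |g x| ≤ M) →
      ∀ x ∈ Ω, |T x * ψ (g x)| ≤ S * C := fun g hg x hx ↦ by
    rw [abs_of_nonneg (mul_nonneg (hTpos x hx).le (hψ0 _))]
    exact mul_le_mul (hTS x hx) (hC _ (hg x hx)) (hψ0 _) ((hTpos x hx).le.trans (hTS x hx))
  have hint1 : IntegrableOn (fun x ↦ T x * ψ (f x / T x)) Ω :=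
    integrableOn_of_continuousOn_of_abs_le hΩ hbdd
      (hT.continuousOn.mul (hψ.continuous.comp_continuousOn
        (hf.continuousOn.div hT.continuousOn hTne))) (hbound _ hr)
  have hint2 : IntegrableOn (fun x ↦ T x * ψ (-laplacian f x)) Ω :=
    integrableOn_of_continuousOn_of_abs_le hΩ hbdd
      (hT.continuousOn.mul (hψ.continuous.comp_continuousOn (continuousOn_laplacian hΩ hf).neg))
      (hbound _ fun x hx ↦ by rw [abs_neg]; exact hfl x hx)
  refine ⟨hint1, hint2, ?_⟩
  by_cases hM : 0 ≤ M
  swap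
  · have : Ω = ∅ := eq_empty_of_forall_notMem fun x hx ↦
      hM ((abs_nonneg _).trans (hfl x hx))
    simp [this]
  have hC0 : 0 ≤ C := (hψ0 0).trans (hC 0 (by simpa using hM))
  set A := ∫ x in Ω, T x * ψ (f x / T x) with hA
  set B := ∫ x in Ω, T x * ψ (-laplacian f x) with hB
  have main : ∀ ε > 0, A ≤ B + 4 * C * ε * volume.real Ω := by
    intro ε hε
    obtain ⟨η, η₁, η₂, hη, hη₁, hηc, hη₁c, hηz, hη₁z, hη₁0, hη₁1, hη₁e, hη₂0, hη₂z, hη0, hηle⟩ :=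
      exists_convex_cutoff hε
    set c := 2 * C * ε with hc
    set w : Fin d → EuclideanSpace ℝ (Fin d) → ℝ := fun i x ↦
      η (T x) * (deriv ψ (f x / T x) * fderiv ℝ f x (EuclideanSpace.single i 1) +
        (ψ (f x / T x) - f x / T x * deriv ψ (f x / T x)) *
          fderiv ℝ T x (EuclideanSpace.single i 1)) +
        (c - T x * ψ (f x / T x)) * η₁ (T x) * fderiv ℝ T x (EuclideanSpace.single i 1) with hw
    have hT1 : ContDiffOn ℝ 1 T Ω := hT.of_le one_le_two
    have hf1 : ContDiffOn ℝ 1 f Ω := hf.of_le one_le_two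
    have hr1 : ContDiffOn ℝ 1 (fun x ↦ f x / T x) Ω := hf1.div hT1 hTne
    have hψr : ContDiffOn ℝ 1 (fun x ↦ ψ (f x / T x)) Ω :=
      (hψ.of_le one_le_two).comp_contDiffOn hr1
    have hψ₁r : ContDiffOn ℝ 1 (fun x ↦ deriv ψ (f x / T x)) Ω := hψ₁.comp_contDiffOn hr1
    have hwc : ∀ i, ContDiffOn ℝ 1 (w i) Ω := fun i ↦
      ((hηc.comp_contDiffOn hT1).mul ((hψ₁r.mul (hf.contDiffOn_fderiv_apply hΩ _)).add
        ((hψr.sub (hr1.mul hψ₁r)).mul (hT.contDiffOn_fderiv_apply hΩ _)))).add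
        (((contDiffOn_const.sub (hT1.mul hψr)).mul (hη₁c.comp_contDiffOn hT1)).mul
          (hT.contDiffOn_fderiv_apply hΩ _))
    set K := closure Ω ∩ T ⁻¹' Ici ε with hK
    have hKc : IsCompact K := hbdd.isCompact_closure.of_isClosed_subset
      (hTc.preimage_isClosed_of_isClosed isClosed_closure isClosed_Ici) inter_subset_left
    have hKΩ : K ⊆ Ω := fun x hx ↦ by
      by_contra h
      have h0 : T x = 0 := hTb x ⟨hx.1, fun h' ↦ h (hΩ.interior_eq ▸ h')⟩
      have h1 : ε ≤ T x := hx.2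
      linarith
    have hw0 : ∀ i, ∀ x ∈ Ω, x ∉ K → w i x = 0 := fun i x hx hxK ↦ by
      have hlt : T x < ε := by
        by_contra! h
        exact hxK ⟨subset_closure hx, h⟩
      simp [hw, hηz _ hlt (hTpos x hx).le, hη₁z _ hlt]
    have hzero := fun i ↦ integrableOn_fderiv_and_integral_eq_zero hΩ hKc hKΩ (hwc i) (hw0 i)
      (EuclideanSpace.single i 1)
    have hsum : ∫ x in Ω, ∑ i, fderiv ℝ (w i) x (EuclideanSpace.single i 1) = 0 := by
      rw [integral_finsetSum _ fun i _ ↦ (hzero i).1]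
      exact Finset.sum_eq_zero fun i _ ↦ (hzero i).2
    have hpt : ∀ x ∈ Ω, T x * ψ (f x / T x) - 2 * c - T x * ψ (-laplacian f x) ≤
        ∑ i, fderiv ℝ (w i) x (EuclideanSpace.single i 1) := by
      intro x hx
      have hTx := hTpos x hx
      set r := f x / T x with hr'
      have hlarge : 2 * ε < T x ∨ T x * ψ r ≤ c := by
        rcases lt_or_ge (2 * ε) (T x) with h | h
        · exact Or.inl h
        · right
          calc T x * ψ r ≤ C * T x := hhC x hx
            _ ≤ C * (2 * ε) := by gcongr
            _ = c := by rw [hc]; ring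
      have hη₂' : 0 ≤ (c - T x * ψ r) * η₂ (T x) := by
        rcases hlarge with h | h
        · simp [hη₂z _ h]
        · exact mul_nonneg (by linarith) (hη₂0 _)
      have hterm : ∀ i : Fin d,
          η (T x) * (deriv ψ r * fderiv ℝ (fderiv ℝ f) x (EuclideanSpace.single i 1)
              (EuclideanSpace.single i 1) +
            (ψ r - r * deriv ψ r) * fderiv ℝ (fderiv ℝ T) x (EuclideanSpace.single i 1)
              (EuclideanSpace.single i 1)) +
            (c - T x * ψ r) * η₁ (T x) * fderiv ℝ (fderiv ℝ T) x (EuclideanSpace.single i 1)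
              (EuclideanSpace.single i 1) ≤
          fderiv ℝ (w i) x (EuclideanSpace.single i 1) := by
        intro i
        set e : EuclideanSpace ℝ (Fin d) := EuclideanSpace.single i 1
        obtain ⟨hf', hf''⟩ := hasLineDerivAt_of_contDiffOn hΩ hf hx e
        obtain ⟨hT', hT''⟩ := hasLineDerivAt_of_contDiffOn hΩ hT hx e
        rw [HasLineDerivAt] at hf' hf'' hT' hT''
        have hψ' := ((hψ₁.differentiable one_ne_zero) r).hasDerivAt
        have hw' : HasDerivAt (fun t : ℝ ↦ w i (x + t • e)) (fderiv ℝ (w i) x e) 0 :=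
          (((hwc i x hx).contDiffAt (hΩ.mem_nhds hx)).differentiableAt
            one_ne_zero).hasFDerivAt.hasLineDerivAt e
        have hder := hasDerivAt_perspective_flux (F := fun t : ℝ ↦ f (x + t • e))
          (T := fun t : ℝ ↦ T (x + t • e)) (F₁ := fun t : ℝ ↦ fderiv ℝ f (x + t • e) e)
          (T₁ := fun t : ℝ ↦ fderiv ℝ T (x + t • e) e) (ψ := ψ) (ψ₁ := deriv ψ)
          (ψ₂ := deriv (deriv ψ) r) (η := η) (η₁ := η₁) (η₂ := η₂ (T x)) (t := 0) c
          (by simpa using hTx.ne') (by simpa using hf') (by simpa using hT') hf'' hT''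
          (hψd _).hasDerivAt (by simpa [← hr'] using hψ') (hη _)
          (by simpa using hη₁ (T x))
        rw [hw'.unique hder]
        simp only [zero_smul, add_zero, ← hr']
        have h1 : 0 ≤ η (T x) * (deriv (deriv ψ) r * T x *
            ((fderiv ℝ f x e - r * fderiv ℝ T x e) / T x) ^ 2) :=
          mul_nonneg (hη0 _ hTx.le) (mul_nonneg (mul_nonneg (hconv.deriv_deriv_nonneg hψd r)
            hTx.le) (sq_nonneg _))
        have h2 := mul_nonneg hη₂' (sq_nonneg (fderiv ℝ T x e))
        linarith
      refine le_trans ?_ (Finset.sum_le_sum fun i _ ↦ hterm i)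
      rw [Finset.sum_add_distrib, ← Finset.mul_sum, Finset.sum_add_distrib, ← Finset.mul_sum,
        ← Finset.mul_sum, ← Finset.mul_sum, ← laplacian_eq_sum_fderiv_fderiv,
        ← laplacian_eq_sum_fderiv_fderiv, hTl x hx]
      have htan := hconv.add_deriv_mul_sub_le hψd r (-laplacian f x)
      have h1 : η (T x) * (ψ r + deriv ψ r * (-laplacian f x - r)) ≤
          T x * ψ (-laplacian f x) :=
        (mul_le_mul_of_nonneg_left htan (hη0 _ hTx.le)).trans
          (mul_le_mul_of_nonneg_right (hηle _ hTx.le) (hψ0 _))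
      have hc0 : 0 ≤ c := by positivity
      have h2 : T x * ψ r - c ≤ T x * ψ r * η₁ (T x) := by
        rcases hlarge with h | h
        · rw [hη₁e _ h]; linarith
        · have := mul_nonneg (mul_nonneg hTx.le (hψ0 r)) (hη₁0 (T x))
          linarith
      have h3 : c * η₁ (T x) ≤ c := mul_le_of_le_one_right hc0 (hη₁1 _)
      linarith
    have hfin : volume Ω ≠ ⊤ := hbdd.measure_lt_top.ne
    have hconst : IntegrableOn (fun _ ↦ 2 * c) Ω := integrableOn_const hfin
    have hle := setIntegral_mono_on ((hint1.sub hconst).sub hint2)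
      (integrable_finsetSum _ fun i _ ↦ (hzero i).1) hΩ.measurableSet hpt
    rw [hsum, integral_sub' (hint1.sub hconst) hint2, integral_sub' hint1 hconst,
      setIntegral_const, smul_eq_mul] at hle
    rw [← hA, ← hB, hc] at hle
    linarith
  have hlim : Tendsto (fun ε : ℝ ↦ B + 4 * C * ε * volume.real Ω) (𝓝[>] 0) (𝓝 B) := by
    have : Continuous fun ε : ℝ ↦ B + 4 * C * ε * volume.real Ω := by fun_prop
    simpa using (this.tendsto 0).mono_left nhdsWithin_le_nhds
  exact ge_of_tendsto hlim (by filter_upwards [self_mem_nhdsWithin] with ε hε using main ε hε)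

lemma convexOn_sq_add_sq_rpow {p : ℝ} (hp : 1 < p) (δ : ℝ) :
    ConvexOn ℝ univ fun r : ℝ ↦ (r ^ 2 + δ ^ 2) ^ (p / 2) := by
  have h1 : ConvexOn ℝ univ fun r : ℝ ↦ ‖(r : ℂ) + δ * Complex.I‖ := by
    refine ⟨convex_univ, fun x _ y _ a b ha hb hab ↦ ?_⟩
    have : (((a • x + b • y : ℝ) : ℂ) + δ * Complex.I) =
        (a : ℂ) * (x + δ * Complex.I) + (b : ℂ) * (y + δ * Complex.I) := by
      have : (a : ℂ) + b = 1 := by exact_mod_cast hab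
      simp only [smul_eq_mul, Complex.ofReal_add, Complex.ofReal_mul]
      linear_combination -(δ * Complex.I) * this
    beta_reduce
    rw [this]
    refine (norm_add_le _ _).trans_eq ?_
    simp [abs_of_nonneg ha, abs_of_nonneg hb]
  have h2 : (fun r : ℝ ↦ (r ^ 2 + δ ^ 2) ^ (p / 2)) =
      (fun t : ℝ ↦ t ^ p) ∘ fun r : ℝ ↦ ‖(r : ℂ) + δ * Complex.I‖ := by
    ext r
    simp only [Function.comp_apply]
    rw [Complex.norm_add_mul_I, Real.sqrt_eq_rpow, ← Real.rpow_mul (by positivity)]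
    ring_nf
  rw [h2]
  refine ⟨convex_univ, fun x _ y _ a b ha hb hab ↦ ?_⟩
  exact (Real.rpow_le_rpow (norm_nonneg _) (h1.2 (mem_univ x) (mem_univ y) ha hb hab)
    (by linarith)).trans ((convexOn_rpow hp.le).2 (norm_nonneg _) (norm_nonneg _) ha hb hab)

lemma laplacian_const_mul_add_const_mul {d : ℕ} {u v : EuclideanSpace ℝ (Fin d) → ℝ}
    {x : EuclideanSpace ℝ (Fin d)} (hu : ContDiffAt ℝ 2 u x) (hv : ContDiffAt ℝ 2 v x) (a b : ℝ) :
    laplacian (fun y ↦ a * u y + b * v y) x = a * laplacian u x + b * laplacian v x := by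
  have key : iteratedFDeriv ℝ 2 (fun y ↦ a * u y + b * v y) x =
      a • iteratedFDeriv ℝ 2 u x + b • iteratedFDeriv ℝ 2 v x := by
    rw [← iteratedFDeriv_const_smul_apply hu, ← iteratedFDeriv_const_smul_apply hv]
    exact iteratedFDeriv_add_apply (hu.const_smul a) (hv.const_smul b)
  simp only [laplacian, Finset.mul_sum, ← Finset.sum_add_distrib]
  exact Finset.sum_congr rfl fun i _ ↦ by rw [key]; rfl

/-- `Lᵖ` estimate in terms of the supremum of the torsion function, for functions
vanishing on the boundary of a bounded regular domain. -/
theorem Lp_estimate_torsion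
    (d : ℕ) (hd : 1 ≤ d) (Ω : Set (EuclideanSpace ℝ (Fin d)))
    (hopen : IsOpen Ω) (hconn : IsConnected Ω) (hbdd : Bornology.IsBounded Ω)
    (hreg : DirichletSolvable d Ω)
    (T₀ : EuclideanSpace ℝ (Fin d) → ℝ)
    (hT₀cont : ContinuousOn T₀ (closure Ω)) (hT₀diff : ContDiffOn ℝ 2 T₀ Ω)
    (hT₀bd : ∀ x ∈ frontier Ω, T₀ x = 0) (hT₀lap : ∀ x ∈ Ω, laplacian T₀ x = -1)
    (f : EuclideanSpace ℝ (Fin d) → ℝ)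
    (hfcont : ContinuousOn f (closure Ω)) (hfdiff : ContDiffOn ℝ 2 f Ω)
    (hfbd : ∀ x ∈ frontier Ω, f x = 0)
    (hΔbdd : ∃ M : ℝ, ∀ x ∈ Ω, |laplacian f x| ≤ M)
    (p q : ℝ) (hp : 1 < p) (hpq : 1 / p + 1 / q = 1) :
    (∫ x in Ω, |f x| ^ p) ^ (1 / p) ≤
      (⨆ x ∈ Ω, T₀ x) ^ ((p + q) / (p * q)) * (∫ x in Ω, |laplacian f x| ^ p) ^ (1 / p) := by
  obtain ⟨M₀, hM₀⟩ := hΔbdd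
  have hp0 : 0 < p := by linarith
  have hq : q ≠ 0 := by
    rintro rfl
    simp only [div_zero, add_zero] at hpq
    rw [div_eq_one_iff_eq hp0.ne'] at hpq
    linarith
  have hexp : (p + q) / (p * q) = 1 := by
    rw [← hpq]
    field_simp
    ring
  rw [hexp, Real.rpow_one]
  set M := |M₀| + 1 with hM
  have hTpos : ∀ x ∈ Ω, 0 < T₀ x := fun x hx ↦
    pos_of_laplacian_neg hopen hbdd hT₀cont hT₀diff hT₀bd
      (fun y hy ↦ by rw [hT₀lap y hy]; norm_num) hx
  have hfl : ∀ x ∈ Ω, |laplacian f x| ≤ M := fun x hx ↦ by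
    linarith [hM₀ x hx, le_abs_self M₀]
  have hcomb : ∀ σ : ℝ, |σ| = 1 → ∀ x ∈ Ω, 0 < M * T₀ x + σ * f x := fun σ hσ x hx ↦ by
    refine pos_of_laplacian_neg (u := fun y ↦ M * T₀ y + σ * f y) hopen hbdd
      ((hT₀cont.const_mul M).add (hfcont.const_mul σ))
      ((contDiffOn_const.mul hT₀diff).add (contDiffOn_const.mul hfdiff))
      (fun y hy ↦ by simp [hT₀bd y hy, hfbd y hy]) (fun y hy ↦ ?_) hx
    rw [laplacian_const_mul_add_const_mul ((hT₀diff y hy).contDiffAt (hopen.mem_nhds hy))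
      ((hfdiff y hy).contDiffAt (hopen.mem_nhds hy)), hT₀lap y hy]
    have h1 : σ * laplacian f y ≤ |laplacian f y| := by
      simpa [abs_mul, hσ] using le_abs_self (σ * laplacian f y)
    linarith [hM₀ y hy, le_abs_self M₀]
  have hfT : ∀ x ∈ Ω, |f x| ≤ M * T₀ x := fun x hx ↦ by
    rw [abs_le]
    have h1 := hcomb 1 (by simp) x hx
    have h2 := hcomb (-1) (by simp) x hx
    constructor <;> linarith
  set S := ⨆ x ∈ Ω, T₀ x with hS
  obtain ⟨C, hC⟩ := hbdd.isCompact_closure.exists_bound_of_continuousOn hT₀cont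
  have hTS : ∀ x ∈ Ω, T₀ x ≤ S := fun x hx ↦ by
    have hbd : BddAbove (range fun y ↦ ⨆ _ : y ∈ Ω, T₀ y) := by
      refine ⟨max C 0, ?_⟩
      rintro _ ⟨y, rfl⟩
      by_cases hy : y ∈ Ω
      · simp only [hy, ciSup_pos]
        exact le_max_of_le_left ((le_abs_self _).trans (hC y (subset_closure hy)))
      · simp [hy]
    simpa [hx] using le_ciSup hbd x
  obtain ⟨x₀, hx₀⟩ := hconn.nonempty
  have hS0 : 0 ≤ S := (hTpos x₀ hx₀).le.trans (hTS x₀ hx₀)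
  have hlapc := continuousOn_laplacian hopen hfdiff
  have hfin : volume Ω ≠ ⊤ := hbdd.measure_lt_top.ne
  have hfint : IntegrableOn (fun x ↦ |f x| ^ p) Ω :=
    ((hfcont.abs.rpow_const fun _ _ ↦ Or.inr hp0.le).integrableOn_compact
      hbdd.isCompact_closure).mono_set subset_closure
  have hψint : ∀ δ : ℝ, IntegrableOn (fun x ↦ (laplacian f x ^ 2 + δ ^ 2) ^ (p / 2)) Ω := by
    intro δ
    refine integrableOn_of_continuousOn_of_abs_le (C := (M ^ 2 + δ ^ 2) ^ (p / 2)) hopen hbdd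
      (((hlapc.pow 2).add continuousOn_const).rpow_const fun _ _ ↦ Or.inr (by positivity))
      fun x hx ↦ ?_
    rw [abs_of_nonneg (by positivity)]
    have := sq_le_sq' (by linarith [(abs_le.1 (hfl x hx)).1]) (abs_le.1 (hfl x hx)).2
    gcongr
  have hδ : ∀ δ > 0, ∫ x in Ω, |f x| ^ p ≤
      S ^ p * ∫ x in Ω, (laplacian f x ^ 2 + δ ^ 2) ^ (p / 2) := by
    intro δ hδ
    have hψsmooth : ContDiff ℝ 2 fun r : ℝ ↦ (r ^ 2 + δ ^ 2) ^ (p / 2) :=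
      (by fun_prop : ContDiff ℝ 2 fun r : ℝ ↦ r ^ 2 + δ ^ 2).rpow_const_of_ne
        fun r ↦ by positivity
    obtain ⟨hi1, hi2, hle⟩ := integral_perspective_le hopen hbdd hT₀cont hT₀diff hT₀bd hT₀lap
      hTpos hTS hfdiff hfT hfl hψsmooth (convexOn_sq_add_sq_rpow hp δ) fun r ↦ by positivity
    simp only [neg_sq] at hi2 hle
    have hSp : S ^ p = S ^ (p - 1) * S := by
      have : 0 < S := (hTpos x₀ hx₀).trans_le (hTS x₀ hx₀)
      rw [Real.rpow_sub_one this.ne']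
      field_simp
    calc ∫ x in Ω, |f x| ^ p
        ≤ ∫ x in Ω, S ^ (p - 1) * (T₀ x * ((f x / T₀ x) ^ 2 + δ ^ 2) ^ (p / 2)) := by
          refine setIntegral_mono_on hfint (hi1.const_mul _) hopen.measurableSet fun x hx ↦ ?_
          have hTx := hTpos x hx
          have h1 : |f x| ^ p = T₀ x ^ (p - 1) * (T₀ x * |f x / T₀ x| ^ p) := by
            rw [abs_div, abs_of_pos hTx, Real.div_rpow (abs_nonneg _) hTx.le,
              Real.rpow_sub_one hTx.ne']
            have := (Real.rpow_pos_of_pos hTx p).ne'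
            field_simp
          have h2 : |f x / T₀ x| ^ p ≤ ((f x / T₀ x) ^ 2 + δ ^ 2) ^ (p / 2) := by
            calc |f x / T₀ x| ^ p = ((f x / T₀ x) ^ 2) ^ (p / 2) := by
                  rw [← sq_abs, ← Real.rpow_natCast_mul (abs_nonneg _)]
                  congr 1
                  push_cast
                  ring
              _ ≤ _ := by
                  have := sq_nonneg δ
                  gcongr
                  linarith
          rw [h1]
          have h3 := Real.rpow_le_rpow hTx.le (hTS x hx) (by linarith : 0 ≤ p - 1)
          gcongr
      _ = S ^ (p - 1) * ∫ x in Ω, T₀ x * ((f x / T₀ x) ^ 2 + δ ^ 2) ^ (p / 2) :=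
          integral_const_mul _ _
      _ ≤ S ^ (p - 1) * ∫ x in Ω, T₀ x * (laplacian f x ^ 2 + δ ^ 2) ^ (p / 2) := by gcongr
      _ ≤ S ^ (p - 1) * ∫ x in Ω, S * (laplacian f x ^ 2 + δ ^ 2) ^ (p / 2) := by
          refine mul_le_mul_of_nonneg_left ?_ (by positivity)
          refine setIntegral_mono_on hi2 ((hψint δ).const_mul _) hopen.measurableSet
            fun x hx ↦ ?_
          exact mul_le_mul_of_nonneg_right (hTS x hx) (by positivity)
      _ = S ^ p * ∫ x in Ω, (laplacian f x ^ 2 + δ ^ 2) ^ (p / 2) := by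
          rw [integral_const_mul, hSp, mul_assoc]
  have hlim : Tendsto (fun δ : ℝ ↦ ∫ x in Ω, (laplacian f x ^ 2 + δ ^ 2) ^ (p / 2)) (𝓝[>] 0)
      (𝓝 (∫ x in Ω, |laplacian f x| ^ p)) := by
    refine tendsto_integral_filter_of_dominated_convergence (fun _ ↦ (M ^ 2 + 1) ^ (p / 2))
      (Eventually.of_forall fun δ ↦ (hψint δ).aestronglyMeasurable) ?_
      (integrableOn_const hfin) (Eventually.of_forall fun x ↦ ?_)
    · filter_upwards [Ioo_mem_nhdsGT (zero_lt_one' ℝ)] with δ hδ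
      refine (ae_restrict_iff' hopen.measurableSet).2 (Eventually.of_forall fun x hx ↦ ?_)
      rw [Real.norm_of_nonneg (by positivity)]
      have h1 := sq_le_sq' (by linarith [(abs_le.1 (hfl x hx)).1]) (abs_le.1 (hfl x hx)).2
      have h2 : δ ^ 2 ≤ 1 := pow_le_one₀ hδ.1.le hδ.2.le
      gcongr
    · have hcont : Continuous fun δ : ℝ ↦ (laplacian f x ^ 2 + δ ^ 2) ^ (p / 2) :=
        (by fun_prop : Continuous fun δ : ℝ ↦ laplacian f x ^ 2 + δ ^ 2).rpow_const
          fun _ ↦ Or.inr (by positivity)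
      have h0 : (laplacian f x ^ 2 + (0 : ℝ) ^ 2) ^ (p / 2) = |laplacian f x| ^ p := by
        rw [zero_pow two_ne_zero, add_zero, ← sq_abs, ← Real.rpow_natCast_mul (abs_nonneg _)]
        congr 1
        push_cast
        ring
      exact h0 ▸ (hcont.tendsto 0).mono_left nhdsWithin_le_nhds
  have hfinal : ∫ x in Ω, |f x| ^ p ≤ S ^ p * ∫ x in Ω, |laplacian f x| ^ p :=
    ge_of_tendsto (hlim.const_mul _)
      (by filter_upwards [self_mem_nhdsWithin] with δ h using hδ δ h)
  have hI : 0 ≤ ∫ x in Ω, |laplacian f x| ^ p := integral_nonneg fun x ↦ by positivity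
  calc (∫ x in Ω, |f x| ^ p) ^ (1 / p)
      ≤ (S ^ p * ∫ x in Ω, |laplacian f x| ^ p) ^ (1 / p) :=
        Real.rpow_le_rpow (integral_nonneg fun x ↦ by positivity) hfinal (by positivity)
    _ = S * (∫ x in Ω, |laplacian f x| ^ p) ^ (1 / p) := by
        rw [Real.mul_rpow (by positivity) hI, one_div, Real.rpow_rpow_inv hS0 hp0.ne']
end
end

section
/- Let d ≥ 2, let 0 < r_1 < ... < r_N, let F ∈ C^4 of the closed annulus {r_1 ≤ |x| ≤ r_N} in ℝ^d, and let I_4(F) be a biharmonic spline for the partition A(r_1,r_2),...,A(r_{N-1},r_N) satisfying I_4(F)(x) = F(x) for all |x| = r_j (j = 1,...,N) and matching the radial (normal) derivative of F on the spheres |x| = r_1 and |x| = r_N. Then for every harmonic spline φ for the partition A(r_1,r_2),...,A(r_{N-1},r_N), the orthogonality relation ∫_{A(r_1,r_N)} (ΔF(x) - Δ I_4(F)(x)) · φ(x) dx = 0 holds. -/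
open MeasureTheory Metric Set Filter Topology

noncomputable section

/-- The open annulus `A(r,R) = {x ∈ ℝᵈ : r < |x| < R}`. -/
def annulus (d : ℕ) (r R : ℝ) : Set (EuclideanSpace ℝ (Fin d)) := {x | r < ‖x‖ ∧ ‖x‖ < R}

/-- The closed annulus `{x ∈ ℝᵈ : r ≤ |x| ≤ R}`. -/
def closedAnnulus (d : ℕ) (r R : ℝ) : Set (EuclideanSpace ℝ (Fin d)) := {x | r ≤ ‖x‖ ∧ ‖x‖ ≤ R}

/-- A harmonic spline for the partition `A(r 0, r 1), ..., A(r (n-1), r n)`: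
continuous on the closed annulus and harmonic on each open subannulus. -/
def HarmonicSpline (d n : ℕ) (r : Fin (n + 1) → ℝ)
    (S : EuclideanSpace ℝ (Fin d) → ℝ) : Prop :=
  ContinuousOn S (closedAnnulus d (r 0) (r (Fin.last n))) ∧
  ∀ i : Fin n, HarmonicOn S (annulus d (r i.castSucc) (r i.succ))

/-- A function is biharmonic on an open set `U` if it is `C⁴` there and `Δ²f = 0` on `U`. -/
def BiharmonicOn {d : ℕ} (f : EuclideanSpace ℝ (Fin d) → ℝ)
    (U : Set (EuclideanSpace ℝ (Fin d))) : Prop :=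
  ContDiffOn ℝ 4 f U ∧ ∀ x ∈ U, laplacian (laplacian f) x = 0

/-- A biharmonic spline for the partition `A(r 0, r 1), ..., A(r (n-1), r n)`:
`C²` on the closed annulus and biharmonic on each open subannulus. -/
def BiharmonicSpline (d n : ℕ) (r : Fin (n + 1) → ℝ)
    (S : EuclideanSpace ℝ (Fin d) → ℝ) : Prop :=
  ContDiffOn ℝ 2 S (closedAnnulus d (r 0) (r (Fin.last n))) ∧
  ∀ i : Fin n, BiharmonicOn S (annulus d (r i.castSucc) (r i.succ))


section Truncation

/-- The `C²` ramp `t ↦ ∫₀ᵗ σ`, where `σ` is a smooth step rising from `0` at `ε` to `1` at `2ε`. -/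
lemma exists_smooth_ramp {ε : ℝ} (hε : 0 < ε) : ∃ σ P : ℝ → ℝ,
    ContDiff ℝ 2 σ ∧ ContDiff ℝ 2 P ∧ (∀ t, HasDerivAt P (σ t) t) ∧ Monotone σ ∧
    (∀ t, 0 ≤ σ t) ∧ (∀ t, σ t ≤ 1) ∧ (∀ t ≤ ε, σ t = 0) ∧ (∀ t, 2 * ε ≤ t → σ t = 1) ∧
    (∀ t ≤ ε, P t = 0) ∧ (∀ t, 0 ≤ t → P t ≤ t ∧ t - 2 * ε ≤ P t) := by
  set σ : ℝ → ℝ := fun t => Real.smoothTransition (t / ε - 1) with hσ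
  have hσc : ContDiff ℝ 2 σ := by
    have : ContDiff ℝ 2 (fun t : ℝ => t / ε - 1) := by fun_prop
    exact Real.smoothTransition.contDiff.comp this
  have hσm : Monotone σ := fun s t hst => Real.smoothTransition.monotone (by gcongr)
  have h0 : ∀ t, 0 ≤ σ t := fun t => Real.smoothTransition.nonneg _
  have h1 : ∀ t, σ t ≤ 1 := fun t => Real.smoothTransition.le_one _
  have hz : ∀ t ≤ ε, σ t = 0 := fun t ht =>
    Real.smoothTransition.zero_of_nonpos (by rw [sub_nonpos, div_le_one hε]; exact ht)
  have ho : ∀ t, 2 * ε ≤ t → σ t = 1 := fun t ht =>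
    Real.smoothTransition.one_of_one_le (by
      have : 2 ≤ t / ε := by rwa [le_div_iff₀ hε]
      linarith)
  set P : ℝ → ℝ := fun t => ∫ s in ε..t, σ s with hP
  have hPd : ∀ t, HasDerivAt P (σ t) t := fun t =>
    intervalIntegral.integral_hasDerivAt_right (hσc.continuous.intervalIntegrable _ _)
      (hσc.continuous.stronglyMeasurableAtFilter _ _) hσc.continuous.continuousAt
  have hPz : ∀ t ≤ ε, P t = 0 := by
    intro t ht
    refine intervalIntegral.integral_zero_ae (ae_of_all _ fun s hs => hz s ?_)
    rw [uIoc_of_ge ht] at hs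
    exact hs.2
  have hPdiff : Differentiable ℝ P := fun t => (hPd t).differentiableAt
  have hder : deriv P = σ := funext fun t => (hPd t).deriv
  refine ⟨σ, P, hσc, ?_, hPd, hσm, h0, h1, hz, ho, hPz, ?_⟩
  · have : ContDiff ℝ (1 + 1) P := by
      rw [contDiff_succ_iff_deriv]
      refine ⟨hPdiff, by simp, ?_⟩
      rw [hder]
      exact hσc.of_le (by norm_num)
    exact this.of_le (by norm_num)
  · have hmono : Monotone fun t => t - P t := by
      refine monotone_of_deriv_nonneg (differentiable_id.sub hPdiff) fun t => ?_
      rw [((hasDerivAt_id' t).fun_sub (hPd t)).deriv]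
      linarith [h1 t]
    have hmP : Monotone P := monotone_of_deriv_nonneg hPdiff fun t => by
      rw [hder]; exact h0 t
    have hanti : AntitoneOn (fun t => t - P t) (Ici (2 * ε)) := by
      refine antitoneOn_of_deriv_nonpos (convex_Ici _)
        (differentiable_id.sub hPdiff).continuous.continuousOn
        (differentiable_id.sub hPdiff).differentiableOn fun t ht => ?_
      rw [((hasDerivAt_id' t).fun_sub (hPd t)).deriv]
      rw [interior_Ici] at ht
      linarith [ho t (le_of_lt ht)]
    intro t ht
    have hP0 : P 0 = 0 := hPz 0 hε.le
    refine ⟨?_, ?_⟩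
    · have := hmono ht
      simp only [hP0] at this
      linarith
    · have hPn : ∀ s, 0 ≤ s → 0 ≤ P s := fun s hs => hP0 ▸ hmP hs
      rcases le_total t (2 * ε) with h | h
      · linarith [hPn t ht]
      · have := hanti (mem_Ici.2 le_rfl) (mem_Ici.2 h) h
        simp only at this
        linarith [hPn (2 * ε) (by positivity)]

/-- A `C²` truncation `G` of the identity which vanishes near `0`, together with a bounded
function `H` whose derivative dominates `|G''|`. -/
lemma exists_truncation {ε : ℝ} (hε : 0 < ε) : ∃ G H : ℝ → ℝ,
    ContDiff ℝ 2 G ∧ ContDiff ℝ 2 H ∧ (∀ t, |t| ≤ ε → G t = 0) ∧ (∀ t, |t - G t| ≤ 2 * ε) ∧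
    (∀ t, 0 ≤ deriv G t ∧ deriv G t ≤ 1) ∧ (∀ t, 2 * ε ≤ |t| → deriv G t = 1) ∧
    (∀ t, |H t| ≤ 1) ∧ ∀ t, |deriv (deriv G) t| ≤ deriv H t := by
  obtain ⟨σ, P, hσc, hPc, hPd, hσm, h0, h1, hz, ho, hPz, hPt⟩ := exists_smooth_ramp hε
  have hPn : ∀ t, HasDerivAt (fun s => P (-s)) (-σ (-t)) t := fun t =>
    ((hPd (-t)).scomp t (hasDerivAt_neg t)).congr_deriv (by simp)
  have hG : ∀ t, HasDerivAt (fun s => P s - P (-s)) (σ t + σ (-t)) t := fun t =>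
    ((hPd t).fun_sub (hPn t)).congr_deriv (by ring)
  have hσd : ∀ t, HasDerivAt σ (deriv σ t) t := fun t =>
    (hσc.differentiable (by norm_num) t).hasDerivAt
  have hσn : ∀ t, HasDerivAt (fun s => σ (-s)) (-deriv σ (-t)) t := fun t =>
    ((hσd (-t)).scomp t (hasDerivAt_neg t)).congr_deriv (by simp)
  have hσ0 : ∀ t, 0 ≤ deriv σ t := fun t => hσm.deriv_nonneg
  have hdG : deriv (fun s => P s - P (-s)) = fun t => σ t + σ (-t) := funext fun t => (hG t).deriv
  refine ⟨fun s => P s - P (-s), fun s => σ s - σ (-s), hPc.sub (hPc.comp contDiff_neg),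
    hσc.sub (hσc.comp contDiff_neg), ?_, ?_, ?_, ?_, ?_, ?_⟩
  · intro t ht
    rw [abs_le] at ht
    simp [hPz t ht.2, hPz (-t) (by linarith)]
  · intro t
    beta_reduce
    rcases le_total 0 t with h | h
    · have := hPt t h
      rw [hPz (-t) (by linarith), abs_le]
      constructor <;> linarith
    · have := hPt (-t) (by linarith)
      rw [hPz t (by linarith), abs_le]
      constructor <;> linarith
  · intro t
    rw [hdG]
    refine ⟨add_nonneg (h0 _) (h0 _), ?_⟩
    rcases le_total 0 t with h | h
    · simp [hz (-t) (by linarith), h1 t]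
    · simp [hz t (by linarith), h1 (-t)]
  · intro t ht
    rw [hdG]
    rcases le_total 0 t with h | h
    · rw [abs_of_nonneg h] at ht
      simp [hz (-t) (by linarith), ho t ht]
    · rw [abs_of_nonpos h] at ht
      simp [hz t (by linarith), ho (-t) ht]
  · intro t
    rw [abs_le]
    constructor <;> linarith [h0 t, h0 (-t), h1 t, h1 (-t)]
  · intro t
    rw [hdG, ((hσd t).fun_add (hσn t)).deriv, ((hσd t).fun_sub (hσn t)).deriv, abs_le]
    constructor <;> linarith [hσ0 t, hσ0 (-t)]

end Truncation

section Divergence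

variable {E : Type*} [NormedAddCommGroup E] [NormedSpace ℝ E] [FiniteDimensional ℝ E]
  [MeasurableSpace E] [BorelSpace E] (μ : Measure E) [μ.IsAddHaarMeasure]

lemma integral_fderiv_eq_zero_of_hasCompactSupport {f : E → ℝ} (hf : ContDiff ℝ 1 f)
    (hc : HasCompactSupport f) (v : E) : ∫ x, fderiv ℝ f x v ∂μ = 0 := by
  have hfd : Continuous fun x => fderiv ℝ f x v :=
    (hf.continuous_fderiv (by norm_num)).clm_apply continuous_const
  have h1 : Integrable (fun x => fderiv ℝ f x v) μ :=
    hfd.integrable_of_hasCompactSupport (hc.fderiv_apply ℝ v)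
  have h2 : Integrable f μ := hf.continuous.integrable_of_hasCompactSupport hc
  have := integral_mul_fderiv_eq_neg_fderiv_mul_of_integrable (μ := μ) (f := fun _ : E => (1 : ℝ))
    (g := f) (v := v) (by simp) (by simpa using h1) (by simpa using h2)
    (fun x _ => by fun_prop) (fun x _ => hf.differentiable (by norm_num) x)
  simpa using this

lemma setIntegral_fderiv_eq_zero_of_isCompact {U C : Set E} (hU : IsOpen U) (hC : IsCompact C)
    (hCU : C ⊆ U) {f : E → ℝ} (hf : ContDiffOn ℝ 1 f U) (hfC : ∀ x ∈ U, x ∉ C → f x = 0) (v : E) :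
    ∫ x in U, fderiv ℝ f x v ∂μ = 0 := by
  set g : E → ℝ := U.indicator f with hg
  have hgC : ∀ x ∉ C, g x = 0 := by
    intro x hx
    by_cases hxU : x ∈ U
    · simp [hg, hxU, hfC x hxU hx]
    · simp [hg, hxU]
  have hgU : ∀ x ∈ U, g =ᶠ[𝓝 x] f := fun x hx => by
    filter_upwards [hU.mem_nhds hx] with y hy
    simp [hg, hy]
  have hgd : ContDiff ℝ 1 g := by
    rw [contDiff_iff_contDiffAt]
    intro x
    by_cases hxU : x ∈ U
    · exact (hf.contDiffAt (hU.mem_nhds hxU)).congr_of_eventuallyEq (hgU x hxU)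
    · have : g =ᶠ[𝓝 x] fun _ => 0 := by
        filter_upwards [hC.isClosed.isOpen_compl.mem_nhds fun h => hxU (hCU h)] with y hy
        exact hgC y hy
      exact contDiffAt_const.congr_of_eventuallyEq this
  have hgc : HasCompactSupport g := HasCompactSupport.intro hC hgC
  rw [← integral_fderiv_eq_zero_of_hasCompactSupport μ hgd hgc v, ← integral_indicator
    hU.measurableSet]
  congr 1 with x
  by_cases hxU : x ∈ U
  · rw [indicator_of_mem hxU, (hgU x hxU).fderiv_eq]
  · have : x ∉ tsupport (fun x => fderiv ℝ g x v) := fun h =>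
      hxU (hCU ((closure_minimal (Function.support_subset_iff'.2 hgC) hC.isClosed)
        (tsupport_fderiv_apply_subset ℝ v h)))
    rw [indicator_of_notMem hxU, image_eq_zero_of_notMem_tsupport this]

/-- The directional derivative of a function vanishes almost everywhere on its zero set. -/
lemma ae_fderivWithin_eq_zero_of_eq_zero {s K : Set E} (hs : MeasurableSet s) (hsK : s ⊆ K)
    {f : E → ℝ} (hf : DifferentiableOn ℝ f K) (h0 : ∀ x ∈ s, f x = 0) (v : E) :
    ∀ᵐ x ∂μ.restrict s, fderivWithin ℝ f K x v = 0 := by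
  rcases eq_or_ne v 0 with rfl | hv
  · simp
  have happ : ApproximatesLinearOn (fun x => f x • v) (0 : E →L[ℝ] E) s 0 := fun x hx y hy => by
    simp [h0 x hx, h0 y hy]
  have := happ.norm_fderiv_sub_le μ hs (fun x => (fderivWithin ℝ f K x).smulRight v) fun x hx =>
    ((hf x (hsK hx)).hasFDerivWithinAt.mono hsK).smul_const v
  filter_upwards [this] with x hx
  have h2 : fderivWithin ℝ f K x = 0 := by simpa [hv] using hx
  simp [h2]

/-- The integral of a directional derivative over an open set `U` with compact closure vanishes
for functions which are `C¹` up to the boundary and zero there. -/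
lemma setIntegral_fderivWithin_eq_zero {U K : Set E} (hU : IsOpen U) (hK : IsCompact K)
    (hUK : U ⊆ K) (hKd : UniqueDiffOn ℝ K) {f : E → ℝ} (hf : ContDiffOn ℝ 1 f K)
    (h0 : ∀ x ∈ K, x ∉ U → f x = 0) (v : E) :
    ∫ x in U, fderivWithin ℝ f K x v ∂μ = 0 := by
  have hpos : ∀ n : ℕ, (0 : ℝ) < 1 / (n + 1) := fun n => Nat.one_div_pos_of_nat
  choose G H hG _ hG0 _ hGd hG1 _ _ using fun n : ℕ => exists_truncation (hpos n)
  have hcont : ContinuousOn (fun x => fderivWithin ℝ f K x v) K :=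
    (hf.continuousOn_fderivWithin hKd (by norm_num)).clm_apply continuousOn_const
  have hint : IntegrableOn (fun x => fderivWithin ℝ f K x v) U μ :=
    (hcont.integrableOn_compact hK).mono_set hUK
  have hz : ∀ n, ∫ x in U, deriv (G n) (f x) * fderivWithin ℝ f K x v ∂μ = 0 := by
    intro n
    have hC : IsCompact (K ∩ f ⁻¹' {t | 1 / ((n : ℝ) + 1) ≤ |t|}) :=
      hK.of_isClosed_subset (hf.continuousOn.preimage_isClosed_of_isClosed hK.isClosed
        (isClosed_le continuous_const continuous_abs)) inter_subset_left
    rw [← setIntegral_fderiv_eq_zero_of_isCompact μ hU hC (f := G n ∘ f) ?_ ?_ ?_ v]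
    · refine setIntegral_congr_fun hU.measurableSet fun x hx => ?_
      have hKx : K ∈ 𝓝 x := mem_of_superset (hU.mem_nhds hx) hUK
      have h1 : HasFDerivAt f (fderivWithin ℝ f K x) x :=
        ((hf.differentiableOn (by norm_num)) x (hUK hx)).hasFDerivWithinAt.hasFDerivAt hKx
      have h2 : HasDerivAt (G n) (deriv (G n) (f x)) (f x) :=
        ((hG n).differentiable (by norm_num) _).hasDerivAt
      simp [(h2.comp_hasFDerivAt x h1).fderiv]
    · rintro x ⟨hxK, hx⟩
      by_contra hxU
      have : 1 / ((n : ℝ) + 1) ≤ |f x| := hx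
      rw [h0 x hxK hxU, abs_zero] at this
      exact absurd this (not_le.2 (hpos n))
    · exact ((hG n).of_le (by norm_num)).comp_contDiffOn (hf.mono hUK)
    · intro x hxU hx
      refine hG0 n _ (le_of_not_ge fun h => hx ⟨hUK hxU, h⟩)
  have hlim : Tendsto (fun n => ∫ x in U, deriv (G n) (f x) * fderivWithin ℝ f K x v ∂μ) atTop
      (𝓝 (∫ x in U, fderivWithin ℝ f K x v ∂μ)) := by
    refine tendsto_integral_of_dominated_convergence (fun x => |fderivWithin ℝ f K x v|) ?_
      hint.abs ?_ ?_
    · intro n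
      refine ContinuousOn.aestronglyMeasurable ?_ hU.measurableSet
      exact ((((hG n).continuous_deriv (by norm_num)).comp_continuousOn hf.continuousOn).mul
        hcont).mono hUK
    · refine fun n => ae_of_all _ fun x => ?_
      rw [Real.norm_eq_abs, abs_mul, abs_of_nonneg (hGd n _).1]
      exact mul_le_of_le_one_left (abs_nonneg _) (hGd n _).2
    · have hs : MeasurableSet (U ∩ (K ∩ f ⁻¹' {0})) := hU.measurableSet.inter
        (hf.continuousOn.preimage_isClosed_of_isClosed hK.isClosed
          isClosed_singleton).measurableSet
      have hae := ae_fderivWithin_eq_zero_of_eq_zero μ hs (fun x hx => hx.2.1)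
        (hf.differentiableOn (by norm_num)) (fun x hx => hx.2.2) v
      rw [ae_restrict_iff' hs] at hae
      filter_upwards [ae_restrict_of_ae hae, ae_restrict_mem hU.measurableSet] with x hx hxU
      by_cases hfx : f x = 0
      · simp [hx ⟨hxU, hUK hxU, hfx⟩]
      · refine tendsto_const_nhds.congr' ?_
        have h2 := (tendsto_one_div_add_atTop_nhds_zero_nat (𝕜 := ℝ)).const_mul 2
        rw [mul_zero] at h2
        filter_upwards [h2.eventually_le_const (abs_pos.2 hfx)] with n hn
        rw [hG1 n _ hn, one_mul]
  simp only [hz] at hlim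
  exact tendsto_nhds_unique hlim tendsto_const_nhds |>.symm ▸ rfl

end Divergence

section PartialDerivatives

variable {d : ℕ} {K U : Set (EuclideanSpace ℝ (Fin d))} {f g : EuclideanSpace ℝ (Fin d) → ℝ}
  {x : EuclideanSpace ℝ (Fin d)}

/-- The `i`-th partial derivative of `f` within `K`. -/
def partialWithin (K : Set (EuclideanSpace ℝ (Fin d))) (i : Fin d)
    (f : EuclideanSpace ℝ (Fin d) → ℝ) (x : EuclideanSpace ℝ (Fin d)) : ℝ :=
  fderivWithin ℝ f K x (EuclideanSpace.single i 1)

/-- The Laplacian of `f` computed with derivatives within `K`. -/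
def laplacianWithin (K : Set (EuclideanSpace ℝ (Fin d))) (f : EuclideanSpace ℝ (Fin d) → ℝ)
    (x : EuclideanSpace ℝ (Fin d)) : ℝ :=
  ∑ i, partialWithin K i (partialWithin K i f) x

lemma contDiffOn_partialWithin (hK : UniqueDiffOn ℝ K) (hf : ContDiffOn ℝ 2 f K) (i : Fin d) :
    ContDiffOn ℝ 1 (partialWithin K i f) K :=
  (hf.fderivWithin hK (by norm_num)).clm_apply contDiffOn_const

lemma continuousOn_partialWithin (hK : UniqueDiffOn ℝ K) (hf : ContDiffOn ℝ 1 f K) (i : Fin d) :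
    ContinuousOn (partialWithin K i f) K :=
  (hf.continuousOn_fderivWithin hK (by norm_num)).clm_apply continuousOn_const

lemma continuousOn_laplacianWithin (hK : UniqueDiffOn ℝ K) (hf : ContDiffOn ℝ 2 f K) :
    ContinuousOn (laplacianWithin K f) K :=
  continuousOn_finsetSum _ fun i _ =>
    continuousOn_partialWithin hK (contDiffOn_partialWithin hK hf i) i

lemma partialWithin_congr (hfg : EqOn f g K) (hx : x ∈ K) (i : Fin d) :
    partialWithin K i f x = partialWithin K i g x := by
  rw [partialWithin, partialWithin, fderivWithin_congr hfg (hfg hx)]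

lemma partialWithin_sub (hK : UniqueDiffOn ℝ K) (hx : x ∈ K) (hf : DifferentiableOn ℝ f K)
    (hg : DifferentiableOn ℝ g K) (i : Fin d) :
    partialWithin K i (fun y => f y - g y) x = partialWithin K i f x - partialWithin K i g x := by
  simp [partialWithin, fderivWithin_fun_sub (hK x hx) (hf x hx) (hg x hx)]

lemma partialWithin_mul (hK : UniqueDiffOn ℝ K) (hx : x ∈ K) (hf : DifferentiableOn ℝ f K)
    (hg : DifferentiableOn ℝ g K) (i : Fin d) :
    partialWithin K i (fun y => f y * g y) x =
      f x * partialWithin K i g x + g x * partialWithin K i f x := by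
  simp [partialWithin, fderivWithin_fun_mul (hK x hx) (hf x hx) (hg x hx)]

lemma partialWithin_comp (hK : UniqueDiffOn ℝ K) (hx : x ∈ K) {G : ℝ → ℝ}
    (hG : Differentiable ℝ G) (hf : DifferentiableOn ℝ f K) (i : Fin d) :
    partialWithin K i (fun y => G (f y)) x = deriv G (f x) * partialWithin K i f x := by
  have := ((hG (f x)).hasDerivAt.comp_hasFDerivWithinAt x (hf x hx).hasFDerivWithinAt).fderivWithin
    (hK x hx)
  change fderivWithin ℝ (G ∘ f) K x _ = _
  rw [this]
  simp [partialWithin]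

lemma laplacianWithin_sub (hK : UniqueDiffOn ℝ K) (hx : x ∈ K) (hf : ContDiffOn ℝ 2 f K)
    (hg : ContDiffOn ℝ 2 g K) :
    laplacianWithin K (fun y => f y - g y) x = laplacianWithin K f x - laplacianWithin K g x := by
  simp only [laplacianWithin, ← Finset.sum_sub_distrib]
  refine Finset.sum_congr rfl fun i _ => ?_
  rw [partialWithin_congr (fun y hy => partialWithin_sub hK hy (hf.differentiableOn (by norm_num))
    (hg.differentiableOn (by norm_num)) i) hx i, partialWithin_sub hK hx
    ((contDiffOn_partialWithin hK hf i).differentiableOn (by norm_num))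
    ((contDiffOn_partialWithin hK hg i).differentiableOn (by norm_num))]

/-- The pointwise form of Green's second identity. -/
lemma sum_partialWithin_green (hK : UniqueDiffOn ℝ K) (hx : x ∈ K) (hf : ContDiffOn ℝ 2 f K)
    (hg : ContDiffOn ℝ 2 g K) :
    ∑ i, partialWithin K i (fun y => f y * partialWithin K i g y - g y * partialWithin K i f y) x =
      f x * laplacianWithin K g x - g x * laplacianWithin K f x := by
  simp only [laplacianWithin, Finset.mul_sum, ← Finset.sum_sub_distrib]
  refine Finset.sum_congr rfl fun i _ => ?_
  have hf1 := hf.differentiableOn (by norm_num)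
  have hg1 := hg.differentiableOn (by norm_num)
  have hf2 := (contDiffOn_partialWithin hK hf i).differentiableOn (by norm_num)
  have hg2 := (contDiffOn_partialWithin hK hg i).differentiableOn (by norm_num)
  rw [partialWithin_sub hK hx (hf1.fun_mul hg2) (hg1.fun_mul hf2), partialWithin_mul hK hx hf1 hg2,
    partialWithin_mul hK hx hg1 hf2]
  ring

/-- The divergence of `H(f) ∇f`. -/
lemma sum_partialWithin_comp_mul (hK : UniqueDiffOn ℝ K) (hx : x ∈ K) {H : ℝ → ℝ}
    (hH : Differentiable ℝ H) (hf : ContDiffOn ℝ 2 f K) :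
    ∑ i, partialWithin K i (fun y => H (f y) * partialWithin K i f y) x =
      H (f x) * laplacianWithin K f x + deriv H (f x) * ∑ i, partialWithin K i f x ^ 2 := by
  simp only [laplacianWithin, Finset.mul_sum, ← Finset.sum_add_distrib]
  refine Finset.sum_congr rfl fun i _ => ?_
  have hf1 := hf.differentiableOn (by norm_num)
  have hf2 := (contDiffOn_partialWithin hK hf i).differentiableOn (by norm_num)
  rw [partialWithin_mul hK hx (f := fun y => H (f y))
    (hH.comp_differentiableOn hf1) hf2, partialWithin_comp hK hx hH hf1]
  ring

lemma laplacianWithin_comp (hK : UniqueDiffOn ℝ K) (hx : x ∈ K) {G : ℝ → ℝ}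
    (hG : ContDiff ℝ 2 G) (hf : ContDiffOn ℝ 2 f K) :
    laplacianWithin K (fun y => G (f y)) x =
      deriv G (f x) * laplacianWithin K f x +
        deriv (deriv G) (f x) * ∑ i, partialWithin K i f x ^ 2 := by
  have hG' : Differentiable ℝ (deriv G) := by
    have : ContDiff ℝ (1 + 1) G := hG
    exact (contDiff_succ_iff_deriv.1 this).2.2.differentiable (by norm_num)
  rw [← sum_partialWithin_comp_mul hK hx hG' hf]
  exact Finset.sum_congr rfl fun i _ => partialWithin_congr (fun y hy => partialWithin_comp hK hy
    (hG.differentiable (by norm_num)) (hf.differentiableOn (by norm_num)) i) hx i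

lemma laplacian_eq_laplacianWithin (hx : K ∈ 𝓝 x) (hf : ContDiffOn ℝ 2 f K) :
    laplacian f x = laplacianWithin K f x := by
  refine Finset.sum_congr rfl fun i _ => ?_
  have h1 : partialWithin K i f =ᶠ[𝓝 x] fun y => fderiv ℝ f y (EuclideanSpace.single i 1) := by
    filter_upwards [eventually_mem_nhds_iff.2 hx] with y hy
    rw [partialWithin, fderivWithin_of_mem_nhds hy]
  have h2 : DifferentiableAt ℝ (fderiv ℝ f) x :=
    ((hf.contDiffAt hx).fderiv_right (m := 1) (by norm_num)).differentiableAt (by norm_num)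
  rw [iteratedFDeriv_two_apply, partialWithin, fderivWithin_of_mem_nhds hx, h1.fderiv_eq,
    fderiv_clm_apply h2 (by fun_prop)]
  simp

lemma setIntegral_sum_partialWithin_eq_zero (hU : IsOpen U) (hK : IsCompact K)
    (hUK : U ⊆ K) (hKd : UniqueDiffOn ℝ K) {w : Fin d → EuclideanSpace ℝ (Fin d) → ℝ}
    (hw : ∀ i, ContDiffOn ℝ 1 (w i) K) (h0 : ∀ i, ∀ x ∈ K, x ∉ U → w i x = 0) :
    ∫ x in U, ∑ i, partialWithin K i (w i) x = 0 := by
  rw [integral_finsetSum _ fun i _ =>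
    ((continuousOn_partialWithin hKd (hw i) i).integrableOn_compact hK).mono_set hUK]
  exact Finset.sum_eq_zero fun i _ => setIntegral_fderivWithin_eq_zero volume hU hK hUK hKd (hw i)
    (h0 i) _

lemma partialWithin_eq_zero_of_isCompact {C : Set (EuclideanSpace ℝ (Fin d))} (hU : IsOpen U)
    (hC : IsCompact C) (hfC : ∀ x ∈ U, x ∉ C → f x = 0) (hxU : x ∈ U) (hxC : x ∉ C) (i : Fin d) :
    partialWithin U i f x = 0 := by
  have : f =ᶠ[𝓝 x] fun _ => 0 := by
    filter_upwards [hU.mem_nhds hxU, hC.isClosed.isOpen_compl.mem_nhds hxC] with y h1 h2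
    exact hfC y h1 h2
  rw [partialWithin, fderivWithin_of_isOpen hU hxU, this.fderiv_eq]
  simp

lemma setIntegral_sum_partialWithin_eq_zero_of_isCompact {C : Set (EuclideanSpace ℝ (Fin d))}
    (hU : IsOpen U) (hC : IsCompact C) (hCU : C ⊆ U) {w : Fin d → EuclideanSpace ℝ (Fin d) → ℝ}
    (hw : ∀ i, ContDiffOn ℝ 1 (w i) U) (h0 : ∀ i, ∀ x ∈ U, x ∉ C → w i x = 0) :
    ∫ x in U, ∑ i, partialWithin U i (w i) x = 0 := by
  rw [integral_finsetSum _ fun i _ => ?_]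
  · refine Finset.sum_eq_zero fun i _ => ?_
    rw [← setIntegral_fderiv_eq_zero_of_isCompact volume hU hC hCU (hw i) (h0 i)
      (EuclideanSpace.single i 1)]
    refine setIntegral_congr_fun hU.measurableSet fun x hx => ?_
    simp only [partialWithin, fderivWithin_of_isOpen hU hx]
  · have hc := continuousOn_partialWithin hU.uniqueDiffOn (hw i) i
    exact ((hc.mono hCU).integrableOn_compact hC).of_forall_sdiff_eq_zero hU.measurableSet
      fun x hx => partialWithin_eq_zero_of_isCompact hU hC (h0 i) hx.1 hx.2 i

end PartialDerivatives

section Orthogonality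

variable {d : ℕ} {K U V : Set (EuclideanSpace ℝ (Fin d))}
  {u φ ψ : EuclideanSpace ℝ (Fin d) → ℝ}

/-- Truncations of a function vanishing on the boundary of `V` have a Laplacian orthogonal to the
harmonic functions on `V`, whatever their boundary behaviour. -/
lemma setIntegral_laplacianWithin_comp_mul_harmonic_eq_zero (hV : IsOpen V) (hK : IsCompact K)
    (hVK : V ⊆ K) (hu : ContDiffOn ℝ 2 u K) (hu0 : ∀ x ∈ K, x ∉ V → u x = 0)
    (hφ : HarmonicOn φ V) {G : ℝ → ℝ} (hG : ContDiff ℝ 2 G) {ε : ℝ} (hε : 0 < ε)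
    (hG0 : ∀ t, |t| ≤ ε → G t = 0) :
    ∫ x in V, φ x * laplacianWithin K (fun y => G (u y)) x = 0 := by
  set g := fun y => G (u y) with hg
  have hgK : ContDiffOn ℝ 2 g K := hG.comp_contDiffOn hu
  have hgV : ContDiffOn ℝ 2 g V := hgK.mono hVK
  have hC : IsCompact (K ∩ u ⁻¹' {t | ε ≤ |t|}) :=
    hK.of_isClosed_subset (hu.continuousOn.preimage_isClosed_of_isClosed hK.isClosed
      (isClosed_le continuous_const continuous_abs)) inter_subset_left
  have hCV : K ∩ u ⁻¹' {t | ε ≤ |t|} ⊆ V := by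
    rintro x ⟨hxK, hx⟩
    by_contra hxV
    have : ε ≤ |u x| := hx
    rw [hu0 x hxK hxV, abs_zero] at this
    exact absurd this (not_le.2 hε)
  have hgC : ∀ x ∈ V, x ∉ K ∩ u ⁻¹' {t | ε ≤ |t|} → g x = 0 := fun x hxV hx =>
    hG0 _ (le_of_not_ge fun h => hx ⟨hVK hxV, h⟩)
  rw [← setIntegral_sum_partialWithin_eq_zero_of_isCompact hV hC hCV
    (w := fun i y => φ y * partialWithin V i g y - g y * partialWithin V i φ y) ?_ ?_]
  · refine setIntegral_congr_fun hV.measurableSet fun x hx => ?_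
    have h1 : laplacianWithin K g x = laplacianWithin V g x := by
      rw [← laplacian_eq_laplacianWithin (hV.mem_nhds hx) hgV,
        laplacian_eq_laplacianWithin (mem_of_superset (hV.mem_nhds hx) hVK) hgK]
    have h2 : laplacianWithin V φ x = 0 := by
      rw [← laplacian_eq_laplacianWithin (hV.mem_nhds hx) hφ.1, hφ.2 x hx]
    simp only [sum_partialWithin_green hV.uniqueDiffOn hx hφ.1 hgV, h1, h2]
    ring
  · intro i
    exact ((hφ.1.of_le (by norm_num)).mul (contDiffOn_partialWithin hV.uniqueDiffOn hgV i)).sub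
      ((hgV.of_le (by norm_num)).mul (contDiffOn_partialWithin hV.uniqueDiffOn hφ.1 i))
  · intro i x hxV hxC
    simp [hgC x hxV hxC, partialWithin_eq_zero_of_isCompact hV hC hgC hxV hxC]

lemma abs_setIntegral_mul_laplacianWithin_le (hU : IsOpen U) (hV : IsOpen V) (hK : IsCompact K)
    (hVU : V ⊆ U) (hUK : U ⊆ K) (hKd : UniqueDiffOn ℝ K) (hUV : V =ᵐ[volume] U)
    (hu : ContDiffOn ℝ 2 u K) (hu0 : ∀ x ∈ K, x ∉ V → u x = 0)
    (hu1 : ∀ i, ∀ x ∈ K, x ∉ U → partialWithin K i u x = 0)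
    (hφc : ContinuousOn φ K) (hφ : HarmonicOn φ V) (hψ : ContDiffOn ℝ 2 ψ K) {δ ε : ℝ}
    (hε : 0 < ε) (hδ : ∀ x ∈ K, |φ x - ψ x| ≤ δ) (hδ0 : 0 ≤ δ) :
    |∫ x in U, φ x * laplacianWithin K u x| ≤
      2 * δ * (∫ x in U, |laplacianWithin K u x|) +
        2 * ε * ∫ x in U, |laplacianWithin K ψ x| := by
  obtain ⟨G, H, hG, hH, hG0, hGt, hG1, -, hHb, hGH⟩ := exists_truncation hε
  set Q : EuclideanSpace ℝ (Fin d) → ℝ := fun x => ∑ i, partialWithin K i u x ^ 2 with hQ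
  have hQ0 : ∀ x, 0 ≤ Q x := fun x => Finset.sum_nonneg fun i _ => sq_nonneg _
  have hu1c : ContDiffOn ℝ 1 u K := hu.of_le (by norm_num)
  have hGu : ContDiffOn ℝ 2 (fun y => G (u y)) K := hG.comp_contDiffOn hu
  have hz : ContDiffOn ℝ 2 (fun y => u y - G (u y)) K := hu.sub hGu
  have hint : ∀ {f : EuclideanSpace ℝ (Fin d) → ℝ}, ContinuousOn f K → IntegrableOn f U :=
    fun hf => (hf.integrableOn_compact hK).mono_set hUK
  have hLu := continuousOn_laplacianWithin hKd hu
  have hLG := continuousOn_laplacianWithin hKd hGu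
  have hLz := continuousOn_laplacianWithin hKd hz
  have hLψ := continuousOn_laplacianWithin hKd hψ
  have hQc : ContinuousOn Q K := continuousOn_finsetSum _ fun i _ =>
    (continuousOn_partialWithin hKd hu1c i).pow 2
  have hHc : ContinuousOn (fun x => H (u x)) K := hH.continuous.comp_continuousOn hu.continuousOn
  have hH'c : ContinuousOn (fun x => deriv H (u x)) K :=
    (hH.continuous_deriv (by norm_num)).comp_continuousOn hu.continuousOn
  have hEnergy : ∫ x in U, (H (u x) * laplacianWithin K u x + deriv H (u x) * Q x) = 0 := by
    rw [← setIntegral_sum_partialWithin_eq_zero hU hK hUK hKd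
      (w := fun i y => H (u y) * partialWithin K i u y) ?_ ?_]
    · exact setIntegral_congr_fun hU.measurableSet fun x hx =>
        (sum_partialWithin_comp_mul hKd (hUK hx) (hH.differentiable (by norm_num)) hu).symm
    · exact fun i => ((hH.of_le (by norm_num)).comp_contDiffOn hu1c).mul
        (contDiffOn_partialWithin hKd hu i)
    · intro i x hxK hxU
      simp [hu1 i x hxK hxU]
  have hGreen : ∫ x in U, (ψ x * laplacianWithin K (fun y => u y - G (u y)) x -
      (u x - G (u x)) * laplacianWithin K ψ x) = 0 := by
    rw [← setIntegral_sum_partialWithin_eq_zero hU hK hUK hKd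
      (w := fun i y => ψ y * partialWithin K i (fun y => u y - G (u y)) y -
        (u y - G (u y)) * partialWithin K i ψ y) ?_ ?_]
    · exact setIntegral_congr_fun hU.measurableSet fun x hx =>
        (sum_partialWithin_green hKd (hUK hx) hψ hz).symm
    · exact fun i => ((hψ.of_le (by norm_num)).mul (contDiffOn_partialWithin hKd hz i)).sub
        ((hz.of_le (by norm_num)).mul (contDiffOn_partialWithin hKd hψ i))
    · intro i x hxK hxU
      have hux : u x = 0 := hu0 x hxK fun h => hxU (hVU h)
      rw [partialWithin_sub hKd hxK (hu.differentiableOn (by norm_num))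
        (hGu.differentiableOn (by norm_num)), partialWithin_comp hKd hxK
        (hG.differentiable (by norm_num)) (hu.differentiableOn (by norm_num)), hu1 i x hxK hxU,
        hux, hG0 0 (by simpa using hε.le)]
      ring
  have hTrunc : ∫ x in U, φ x * laplacianWithin K (fun y => G (u y)) x = 0 := by
    rw [← setIntegral_congr_set hUV]
    exact setIntegral_laplacianWithin_comp_mul_harmonic_eq_zero hV hK (hVU.trans hUK) hu hu0 hφ hG
      hε hG0
  have hsplit : ∫ x in U, φ x * laplacianWithin K u x =
      ∫ x in U, ((φ x - ψ x) * laplacianWithin K (fun y => u y - G (u y)) x +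
        (u x - G (u x)) * laplacianWithin K ψ x) := by
    have h1 : IntegrableOn (fun x => φ x * laplacianWithin K (fun y => G (u y)) x) U :=
      hint (hφc.mul hLG)
    have h2 : IntegrableOn (fun x => ψ x * laplacianWithin K (fun y => u y - G (u y)) x -
        (u x - G (u x)) * laplacianWithin K ψ x) U :=
      hint ((hψ.continuousOn.mul hLz).sub (hz.continuousOn.mul hLψ))
    have h3 : IntegrableOn (fun x => φ x * laplacianWithin K u x) U := hint (hφc.mul hLu)
    have h4 := integral_sub (h3.sub h1) h2
    simp only [Pi.sub_apply] at h4
    rw [integral_sub h3 h1, hTrunc, hGreen, sub_zero, sub_zero] at h4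
    rw [← h4]
    refine setIntegral_congr_fun hU.measurableSet fun x hx => ?_
    simp only [laplacianWithin_sub hKd (hUK hx) hu hGu]
    ring
  have hbound : ∀ x ∈ U, |(φ x - ψ x) * laplacianWithin K (fun y => u y - G (u y)) x +
      (u x - G (u x)) * laplacianWithin K ψ x| ≤
      2 * δ * |laplacianWithin K u x| + 2 * ε * |laplacianWithin K ψ x| +
        δ * (H (u x) * laplacianWithin K u x + deriv H (u x) * Q x) := by
    intro x hx
    have hxK := hUK hx
    have e1 : |laplacianWithin K (fun y => u y - G (u y)) x| ≤
        |laplacianWithin K u x| + deriv H (u x) * Q x := by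
      rw [laplacianWithin_sub hKd hxK hu hGu, laplacianWithin_comp hKd hxK hG hu]
      have a1 : |(1 - deriv G (u x)) * laplacianWithin K u x| ≤ |laplacianWithin K u x| := by
        rw [abs_mul]
        refine mul_le_of_le_one_left (abs_nonneg _) ?_
        rw [abs_le]
        constructor <;> linarith [(hG1 (u x)).1, (hG1 (u x)).2]
      have a2 : |deriv (deriv G) (u x) * Q x| ≤ deriv H (u x) * Q x := by
        rw [abs_mul, abs_of_nonneg (hQ0 x)]
        exact mul_le_mul_of_nonneg_right (hGH _) (hQ0 x)
      calc _ = |(1 - deriv G (u x)) * laplacianWithin K u x - deriv (deriv G) (u x) * Q x| := by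
            congr 1; ring
        _ ≤ _ := (abs_sub _ _).trans (add_le_add a1 a2)
    have e2 : -|laplacianWithin K u x| ≤ H (u x) * laplacianWithin K u x := by
      refine (abs_le.1 ?_).1
      rw [abs_mul]
      exact mul_le_of_le_one_left (abs_nonneg _) (hHb _)
    have e3 : |(φ x - ψ x) * laplacianWithin K (fun y => u y - G (u y)) x| ≤
        δ * (|laplacianWithin K u x| + deriv H (u x) * Q x) := by
      rw [abs_mul]
      exact mul_le_mul (hδ x hxK) e1 (abs_nonneg _) hδ0
    have e4 : |(u x - G (u x)) * laplacianWithin K ψ x| ≤ 2 * ε * |laplacianWithin K ψ x| := by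
      rw [abs_mul]
      exact mul_le_mul_of_nonneg_right (hGt _) (abs_nonneg _)
    have e5 := mul_le_mul_of_nonneg_left e2 hδ0
    refine (abs_add_le _ _).trans ((add_le_add e3 e4).trans ?_)
    linarith
  have i1 : IntegrableOn (fun x => 2 * δ * |laplacianWithin K u x|) U :=
    hint (continuousOn_const.mul hLu.abs)
  have i2 : IntegrableOn (fun x => 2 * ε * |laplacianWithin K ψ x|) U :=
    hint (continuousOn_const.mul hLψ.abs)
  have i3 : IntegrableOn (fun x => δ * (H (u x) * laplacianWithin K u x + deriv H (u x) * Q x)) U :=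
    hint (continuousOn_const.mul ((hHc.mul hLu).add (hH'c.mul hQc)))
  rw [hsplit]
  refine (abs_integral_le_integral_abs).trans ((setIntegral_mono_on
    (hint (((hφc.sub hψ.continuousOn).mul hLz).add (hz.continuousOn.mul hLψ)).abs)
    ((i1.add i2).add i3) hU.measurableSet hbound).trans_eq ?_)
  simp only [Pi.add_apply]
  rw [integral_add (f := fun x => 2 * δ * |laplacianWithin K u x| + 2 * ε * |laplacianWithin K ψ x|)
    (i1.add i2) i3, integral_add i1 i2, integral_const_mul, integral_const_mul,
    integral_const_mul, hEnergy]
  ring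

lemma setIntegral_mul_laplacianWithin_eq_zero (hU : IsOpen U) (hV : IsOpen V) (hK : IsCompact K)
    (hVU : V ⊆ U) (hUK : U ⊆ K) (hKd : UniqueDiffOn ℝ K) (hUV : V =ᵐ[volume] U)
    (hu : ContDiffOn ℝ 2 u K) (hu0 : ∀ x ∈ K, x ∉ V → u x = 0)
    (hu1 : ∀ i, ∀ x ∈ K, x ∉ U → partialWithin K i u x = 0)
    (hφc : ContinuousOn φ K) (hφ : HarmonicOn φ V) :
    ∫ x in U, φ x * laplacianWithin K u x = 0 := by
  have happrox : ∀ δ > 0, |∫ x in U, φ x * laplacianWithin K u x| ≤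
      2 * δ * ∫ x in U, |laplacianWithin K u x| := by
    intro δ hδ
    obtain ⟨φ', hφ'⟩ := ContinuousMap.exists_restrict_eq hK.isClosed ⟨K.domRestrict φ, hφc.domRestrict⟩
    have hφ'K : ∀ x ∈ K, φ' x = φ x := fun x hx => congrArg (fun f : C(K, ℝ) => f ⟨x, hx⟩) hφ'
    obtain ⟨ψ, hψ, hψδ, -⟩ := φ'.continuous.exists_contDiff_approx 2 (ε := fun _ => δ)
      continuous_const fun _ => hδ
    have hle : ∀ ε > 0, |∫ x in U, φ x * laplacianWithin K u x| ≤
        2 * δ * (∫ x in U, |laplacianWithin K u x|) +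
          2 * ε * ∫ x in U, |laplacianWithin K ψ x| := fun ε hε =>
      abs_setIntegral_mul_laplacianWithin_le hU hV hK hVU hUK hKd hUV hu hu0 hu1 hφc hφ
        hψ.contDiffOn hε (fun x hx => by
          rw [← hφ'K x hx, abs_sub_comm, ← Real.dist_eq]
          exact (hψδ x).le) hδ.le
    have hlim : Tendsto (fun ε : ℝ => 2 * δ * (∫ x in U, |laplacianWithin K u x|) +
        2 * ε * ∫ x in U, |laplacianWithin K ψ x|) (𝓝[>] 0)
        (𝓝 (2 * δ * (∫ x in U, |laplacianWithin K u x|) +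
          2 * 0 * ∫ x in U, |laplacianWithin K ψ x|)) :=
      (Continuous.tendsto (by fun_prop) 0).mono_left nhdsWithin_le_nhds
    simpa using ge_of_tendsto hlim (eventually_mem_nhdsWithin.mono hle)
  have hlim : Tendsto (fun δ : ℝ => 2 * δ * ∫ x in U, |laplacianWithin K u x|) (𝓝[>] 0)
      (𝓝 (2 * 0 * ∫ x in U, |laplacianWithin K u x|)) :=
    (Continuous.tendsto (by fun_prop) 0).mono_left nhdsWithin_le_nhds
  simpa using ge_of_tendsto hlim (eventually_mem_nhdsWithin.mono happrox)

end Orthogonality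

section Annulus

variable {d : ℕ} {a b : ℝ}

lemma isOpen_annulus (d : ℕ) (a b : ℝ) : IsOpen (annulus d a b) :=
  (isOpen_lt continuous_const continuous_norm).inter (isOpen_lt continuous_norm continuous_const)

lemma isCompact_closedAnnulus (d : ℕ) (a b : ℝ) : IsCompact (closedAnnulus d a b) :=
  (isCompact_closedBall (0 : EuclideanSpace ℝ (Fin d)) b).of_isClosed_subset
    ((isClosed_le continuous_const continuous_norm).inter
      (isClosed_le continuous_norm continuous_const)) fun x hx => by simpa using hx.2

lemma annulus_subset_closedAnnulus : annulus d a b ⊆ closedAnnulus d a b :=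
  fun _ hx => ⟨hx.1.le, hx.2.le⟩

lemma uniqueDiffOn_closedAnnulus (ha : 0 < a) (hab : a < b) :
    UniqueDiffOn ℝ (closedAnnulus d a b) := by
  intro x hx
  have hx0 : 0 < ‖x‖ := ha.trans_le hx.1
  set c : EuclideanSpace ℝ (Fin d) := ((a + b) / 2 / ‖x‖) • x with hc
  have hcn : ‖c‖ = (a + b) / 2 := by
    rw [hc, norm_smul, Real.norm_of_nonneg (div_nonneg (by linarith) hx0.le), div_mul_cancel₀ _ hx0.ne']
  have hxc : x ∈ closedBall c ((b - a) / 2) := by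
    have : x - c = (1 - (a + b) / 2 / ‖x‖) • x := by rw [hc, sub_smul, one_smul]
    rw [mem_closedBall, dist_eq_norm, this, norm_smul, Real.norm_eq_abs,
      ← abs_of_nonneg (norm_nonneg x), ← abs_mul, abs_norm, sub_mul, div_mul_cancel₀ _ hx0.ne',
      abs_le]
    constructor <;> linarith [hx.1, hx.2]
  have hsub : closedBall c ((b - a) / 2) ⊆ closedAnnulus d a b := by
    intro y hy
    rw [mem_closedBall, dist_eq_norm] at hy
    have h1 := abs_le.1 ((abs_norm_sub_norm_le y c).trans hy)
    constructor <;> linarith [h1.1, h1.2]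
  refine (uniqueDiffWithinAt_convex (convex_closedBall c _) ?_ (subset_closure hxc)).mono hsub
  exact ⟨c, ball_subset_interior_closedBall (mem_ball_self (by linarith))⟩

/-- Tangential derivatives vanish on spheres on which a function vanishes. -/
lemma fderivWithin_apply_eq_zero_of_inner_eq_zero {K : Set (EuclideanSpace ℝ (Fin d))}
    {u : EuclideanSpace ℝ (Fin d) → ℝ} {x v : EuclideanSpace ℝ (Fin d)} (hx0 : x ≠ 0)
    (hu : DifferentiableOn ℝ u K) (hx : x ∈ K) (hK : ∀ y, ‖y‖ = ‖x‖ → y ∈ K)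
    (h0 : ∀ y, ‖y‖ = ‖x‖ → u y = 0) (hv : inner ℝ x v = 0) : fderivWithin ℝ u K x v = 0 := by
  rcases eq_or_ne v 0 with rfl | hv0
  · simp
  have hvn : ‖v‖ ≠ 0 := norm_ne_zero_iff.2 hv0
  set w := (‖x‖ / ‖v‖) • v with hw
  have hwn : ‖w‖ = ‖x‖ := by
    rw [hw, norm_smul, Real.norm_of_nonneg (by positivity), div_mul_cancel₀ _ hvn]
  have hxw : inner ℝ x w = 0 := by rw [hw, inner_smul_right, hv, mul_zero]
  set γ : ℝ → EuclideanSpace ℝ (Fin d) := fun t => Real.cos t • x + Real.sin t • w with hγ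
  have hγn : ∀ t, ‖γ t‖ = ‖x‖ := by
    intro t
    have : ‖γ t‖ ^ 2 = ‖x‖ ^ 2 := by
      rw [hγ, norm_add_sq_real, inner_smul_left, inner_smul_right, hxw, norm_smul, norm_smul, hwn,
        mul_pow, mul_pow, Real.norm_eq_abs, Real.norm_eq_abs, sq_abs, sq_abs]
      simp only [mul_zero, add_zero]
      rw [← add_mul, Real.cos_sq_add_sin_sq, one_mul]
    exact (sq_eq_sq₀ (norm_nonneg _) (norm_nonneg _)).1 this
  have hγ0 : γ 0 = x := by simp [hγ]
  have hγd : HasDerivAt γ w 0 :=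
    (((Real.hasDerivAt_cos 0).smul_const x).fun_add
      ((Real.hasDerivAt_sin 0).smul_const w)).congr_deriv (by simp)
  have h1 : HasDerivAt (u ∘ γ) (fderivWithin ℝ u K x w) 0 :=
    HasFDerivWithinAt.comp_hasDerivAt_of_eq 0 (hu x hx).hasFDerivWithinAt hγd
      (Eventually.of_forall fun t => hK _ (hγn t)) hγ0.symm
  have h2 : u ∘ γ = fun _ => 0 := funext fun t => h0 _ (hγn t)
  rw [h2] at h1
  have h3 : fderivWithin ℝ u K x w = 0 := h1.unique (hasDerivAt_const 0 0)
  rw [hw, map_smul, smul_eq_mul] at h3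
  exact (mul_eq_zero.1 h3).resolve_left (div_ne_zero (norm_ne_zero_iff.2 hx0) hvn)

lemma fderivWithin_eq_zero_of_sphere {K : Set (EuclideanSpace ℝ (Fin d))}
    {u : EuclideanSpace ℝ (Fin d) → ℝ} {x : EuclideanSpace ℝ (Fin d)} (hx0 : x ≠ 0)
    (hu : DifferentiableOn ℝ u K) (hK : ∀ y, ‖y‖ = ‖x‖ → y ∈ K) (h0 : ∀ y, ‖y‖ = ‖x‖ → u y = 0)
    (hn : fderivWithin ℝ u K x x = 0) : fderivWithin ℝ u K x = 0 := by
  ext v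
  have hxx : inner ℝ x x ≠ 0 := inner_self_ne_zero.2 hx0
  have h1 : inner ℝ x (v - (inner ℝ x v / inner ℝ x x) • x) = 0 := by
    rw [inner_sub_right, inner_smul_right, div_mul_cancel₀ _ hxx, sub_self]
  have h2 := fderivWithin_apply_eq_zero_of_inner_eq_zero hx0 hu (hK x rfl) hK h0 h1
  rw [map_sub, map_smul, hn, smul_zero, sub_zero] at h2
  simpa using h2

lemma exists_mem_Ioo_of_forall_ne {n : ℕ} {r : Fin (n + 1) → ℝ} {t : ℝ} (h0 : r 0 < t)
    (h1 : t < r (Fin.last n)) (hne : ∀ i, t ≠ r i) :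
    ∃ i : Fin n, r i.castSucc < t ∧ t < r i.succ := by
  by_contra! h
  have : ∀ i : Fin (n + 1), r i < t := fun i =>
    Fin.induction h0 (fun j hj => lt_of_le_of_ne (h j hj) (hne _).symm) i
  exact absurd h1 (this _).not_gt

lemma harmonicOn_of_harmonicSpline {n : ℕ} {r : Fin (n + 1) → ℝ}
    {φ : EuclideanSpace ℝ (Fin d) → ℝ} (hφ : HarmonicSpline d n r φ) :
    HarmonicOn φ (annulus d (r 0) (r (Fin.last n)) ∩ {x | ∀ i, ‖x‖ ≠ r i}) := by
  refine ⟨fun x hx => ?_, fun x hx => ?_⟩ <;>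
  obtain ⟨i, hi⟩ := exists_mem_Ioo_of_forall_ne hx.1.1 hx.1.2 hx.2
  · exact ((hφ.2 i).1.contDiffAt ((isOpen_annulus d _ _).mem_nhds hi)).contDiffWithinAt
  · exact (hφ.2 i).2 x hi

end Annulus

/-- Orthogonality relation: the Laplacian of the error of biharmonic spline
interpolation is `L²`-orthogonal to every harmonic spline. -/
theorem biharmonic_spline_orthogonality
    (d n : ℕ) (hd : 2 ≤ d) (hn : 1 ≤ n) (r : Fin (n + 1) → ℝ)
    (hr0 : 0 < r 0) (hr : StrictMono r)
    (F S : EuclideanSpace ℝ (Fin d) → ℝ)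
    (hF : ContDiffOn ℝ 4 F (closedAnnulus d (r 0) (r (Fin.last n))))
    (hS : BiharmonicSpline d n r S)
    (hinterp : ∀ (i : Fin (n + 1)) (x : EuclideanSpace ℝ (Fin d)), ‖x‖ = r i → S x = F x)
    (hnormal : ∀ x : EuclideanSpace ℝ (Fin d), (‖x‖ = r 0 ∨ ‖x‖ = r (Fin.last n)) →
      fderivWithin ℝ S (closedAnnulus d (r 0) (r (Fin.last n))) x x =
      fderivWithin ℝ F (closedAnnulus d (r 0) (r (Fin.last n))) x x)
    (φ : EuclideanSpace ℝ (Fin d) → ℝ) (hφ : HarmonicSpline d n r φ) :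
    ∫ x in annulus d (r 0) (r (Fin.last n)),
      (laplacian F x - laplacian S x) * φ x = 0 := by
  set K := closedAnnulus d (r 0) (r (Fin.last n)) with hKdef
  set U := annulus d (r 0) (r (Fin.last n)) with hUdef
  set V := U ∩ {x | ∀ i, ‖x‖ ≠ r i} with hVdef
  have hrpos : ∀ i, 0 < r i := fun i => hr0.trans_le (hr.monotone (Fin.zero_le i))
  have h0l : r 0 < r (Fin.last n) := hr (Fin.lt_def.2 (by simp; omega))
  have hKd : UniqueDiffOn ℝ K := uniqueDiffOn_closedAnnulus hr0 h0l
  have hKc : IsCompact K := isCompact_closedAnnulus d _ _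
  have hU : IsOpen U := isOpen_annulus d _ _
  have hUK : U ⊆ K := annulus_subset_closedAnnulus
  have hV : IsOpen V := by
    have : {x : EuclideanSpace ℝ (Fin d) | ∀ i, ‖x‖ ≠ r i} = ⋂ i, {x | ‖x‖ ≠ r i} := by
      ext; simp
    rw [hVdef, this]
    exact hU.inter (isOpen_iInter_of_finite fun i => isOpen_ne_fun continuous_norm continuous_const)
  have hUV : V =ᵐ[volume] U := by
    refine inter_ae_eq_left_of_ae_eq_univ (eventuallyEq_univ.2 ?_)
    change ∀ᵐ x, ∀ i, ‖x‖ ≠ r i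
    rw [ae_all_iff]
    intro i
    have := Measure.addHaar_sphere_of_ne_zero volume (0 : EuclideanSpace ℝ (Fin d)) (hrpos i).ne'
    filter_upwards [measure_eq_zero_iff_ae_notMem.1 this] with x hx
    simpa using hx
  have hF2 : ContDiffOn ℝ 2 F K := hF.of_le (by norm_num)
  have hu : ContDiffOn ℝ 2 (fun x => F x - S x) K := hF2.sub hS.1
  have hbdry : ∀ x ∈ K, x ∉ U → ‖x‖ = r 0 ∨ ‖x‖ = r (Fin.last n) := by
    intro x hx hxU
    by_contra! h
    exact hxU ⟨lt_of_le_of_ne hx.1 h.1.symm, lt_of_le_of_ne hx.2 h.2⟩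
  have hu0 : ∀ x ∈ K, x ∉ V → F x - S x = 0 := by
    intro x hx hxV
    have : ∃ i, ‖x‖ = r i := by
      by_contra! h
      refine hxV ⟨?_, h⟩
      by_contra hxU
      rcases hbdry x hx hxU with h' | h'
      exacts [h _ h', h _ h']
    obtain ⟨i, hi⟩ := this
    rw [hinterp i x hi, sub_self]
  have hu1 : ∀ i, ∀ x ∈ K, x ∉ U → partialWithin K i (fun x => F x - S x) x = 0 := by
    intro i x hx hxU
    have hsphere : ∀ y : EuclideanSpace ℝ (Fin d), ‖y‖ = ‖x‖ → y ∈ K ∧ y ∉ U := fun y hy => by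
      simpa [hKdef, hUdef, closedAnnulus, annulus, hy] using And.intro hx hxU
    have hnx : fderivWithin ℝ (fun x => F x - S x) K x x = 0 := by
      rw [fderivWithin_fun_sub (hKd x hx) (hF2.differentiableOn (by norm_num) x hx)
        (hS.1.differentiableOn (by norm_num) x hx)]
      simp [hnormal x (hbdry x hx hxU)]
    rw [partialWithin, fderivWithin_eq_zero_of_sphere (norm_pos_iff.1 (hr0.trans_le hx.1))
      (hu.differentiableOn (by norm_num)) (fun y hy => (hsphere y hy).1)
      (fun y hy => hu0 y (hsphere y hy).1 fun h => (hsphere y hy).2 h.1) hnx]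
    rfl
  rw [← setIntegral_mul_laplacianWithin_eq_zero hU hV hKc inter_subset_left hUK hKd hUV hu
    hu0 hu1 hφ.1 (harmonicOn_of_harmonicSpline hφ)]
  refine setIntegral_congr_fun hU.measurableSet fun x hx => ?_
  have hKx : K ∈ 𝓝 x := mem_of_superset (hU.mem_nhds hx) hUK
  simp only [laplacianWithin_sub hKd (hUK hx) hF2 hS.1, laplacian_eq_laplacianWithin hKx hF2,
    laplacian_eq_laplacianWithin hKx hS.1]
  ring
end
end

section
/- Let D = (d-2)/2 > 0 (i.e. d > 2) and define B_d(ρ) = ρ^{2D}(1-ρ^2)/(1-ρ^{2D}) for ρ ∈ (0,1). Then: (i) B_d is positive and strictly increasing on (0,1); (ii) lim_{ρ→1⁻} B_d(ρ) = 1/D; (iii) lim_{ρ→1⁻} B_d'(ρ) = (D+1)/D; (iv) lim_{ρ→1⁻} B_d'''(ρ) = 0; (v) B_d''' is positive on (0,1) when D > 1 and negative on (0,1) when 1/2 < D < 1; and (vi) for ρ ∈ (0,1), B_d'(ρ)/B_d(ρ) = 2(D - ρ^2 + ρ^{2D+2} - ρ^2 D) / (ρ (1-ρ^{2D})(1-ρ^2)).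 -/
open Set Filter Topology

noncomputable section

namespace Bd

/-- The third derivative of `ρ^a (1 - ρ²) / (1 - ρ^a)` has the sign of `P(ρ^a) - ρ² Q(ρ^a)`,
where `P = polyP a` and `Q = polyQ a`. -/
def polyP (a u : ℝ) : ℝ :=
  a ^ 2 * (1 + 4 * u + u ^ 2) - 3 * a * (1 - u ^ 2) + 2 * (1 - u) ^ 2

/-- The reciprocal polynomial of `polyP a`. -/
def polyQ (a u : ℝ) : ℝ :=
  a ^ 2 * (1 + 4 * u + u ^ 2) + 3 * a * (1 - u ^ 2) + 2 * (1 - u) ^ 2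

/-- The factor carrying the sign of the first derivative. -/
def firstNumer (a x : ℝ) : ℝ := a * (1 - x ^ 2) - 2 * x ^ 2 * (1 - x ^ a)

/-- The first derivative on `(0, 1)`. -/
def firstDeriv (a x : ℝ) : ℝ := x ^ a * firstNumer a x / (x * (1 - x ^ a) ^ 2)

/-- The second derivative on `(0, 1)`. -/
def secondDeriv (a x : ℝ) : ℝ :=
  x ^ a * (a ^ 2 * (1 + x ^ a) - a * (1 - x ^ a)
    - x ^ 2 * (a ^ 2 * (1 + x ^ a) + 3 * a * (1 - x ^ a) + 2 * (1 - x ^ a) ^ 2))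
    / (x ^ 2 * (1 - x ^ a) ^ 3)

/-- The third derivative on `(0, 1)`. -/
def thirdDeriv (a x : ℝ) : ℝ :=
  a * x ^ a * (polyP a (x ^ a) - x ^ 2 * polyQ a (x ^ a)) / (x ^ 3 * (1 - x ^ a) ^ 4)

/-- The ratio whose comparison with `1` gives the sign of the third derivative. -/
def ratio (a x : ℝ) : ℝ := polyP a (x ^ a) / (x ^ 2 * polyQ a (x ^ a))

variable {a x : ℝ}

lemma hasDerivAt_rpow (hx : 0 < x) : HasDerivAt (fun y : ℝ => y ^ a) (a * x ^ a / x) x := by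
  convert Real.hasDerivAt_rpow_const (p := a) (Or.inl hx.ne') using 1
  rw [Real.rpow_sub_one hx.ne', mul_div_assoc]

lemma rpow_mem_Ioo (ha : 0 < a) (hx : x ∈ Ioo (0 : ℝ) 1) : x ^ a ∈ Ioo (0 : ℝ) 1 :=
  ⟨Real.rpow_pos_of_pos hx.1 a, Real.rpow_lt_one hx.1.le hx.2 ha⟩

lemma sq_le_polyQ {u : ℝ} (ha : 0 < a) (h0 : 0 ≤ u) (h1 : u ≤ 1) : a ^ 2 ≤ polyQ a u := by
  have h2 : 0 ≤ a ^ 2 * (4 * u + u ^ 2) := by positivity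
  have h3 : 0 ≤ 3 * a * (1 - u ^ 2) := mul_nonneg (by positivity) (by nlinarith)
  unfold polyQ
  nlinarith [sq_nonneg (1 - u)]

lemma polyQ_pos {u : ℝ} (ha : 0 < a) (h0 : 0 ≤ u) (h1 : u ≤ 1) : 0 < polyQ a u :=
  (pow_pos ha 2).trans_le (sq_le_polyQ ha h0 h1)

lemma hasDerivAt_base (ha : 0 < a) (hx : x ∈ Ioo (0 : ℝ) 1) :
    HasDerivAt (fun y : ℝ => y ^ a * (1 - y ^ 2) / (1 - y ^ a)) (firstDeriv a x) x := by
  have hu := sub_ne_zero.2 (rpow_mem_Ioo ha hx).2.ne'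
  have h := hasDerivAt_rpow (a := a) hx.1
  have hx0 := hx.1.ne'
  refine HasDerivAt.congr_deriv ((h.mul ((hasDerivAt_pow 2 x).const_sub 1)).div (h.const_sub 1) hu) ?_
  simp only [firstDeriv, firstNumer, Pi.mul_apply]
  generalize x ^ a = u at *
  field_simp
  push_cast
  ring

lemma hasDerivAt_firstNumer (hx : 0 < x) :
    HasDerivAt (firstNumer a) (-2 * (a + 2) * x * (1 - x ^ a)) x := by
  have h := hasDerivAt_rpow (a := a) hx
  refine HasDerivAt.congr_deriv ((((hasDerivAt_pow 2 x).const_sub 1).const_mul a).sub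
    (((hasDerivAt_pow 2 x).const_mul 2).mul (h.const_sub 1))) ?_
  have := hx.ne'
  generalize x ^ a = u at *
  field_simp
  push_cast
  ring

lemma hasDerivAt_firstDeriv (ha : 0 < a) (hx : x ∈ Ioo (0 : ℝ) 1) :
    HasDerivAt (firstDeriv a) (secondDeriv a x) x := by
  have hu := sub_ne_zero.2 (rpow_mem_Ioo ha hx).2.ne'
  have h := hasDerivAt_rpow (a := a) hx.1
  have hx0 := hx.1.ne'
  refine HasDerivAt.congr_deriv ((h.mul (hasDerivAt_firstNumer hx.1)).div
    ((hasDerivAt_id x).mul ((h.const_sub 1).pow 2)) (mul_ne_zero hx0 (pow_ne_zero 2 hu))) ?_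
  simp only [secondDeriv, firstNumer, Pi.mul_apply, id]
  generalize x ^ a = u at *
  field_simp
  push_cast
  ring

lemma hasDerivAt_secondDeriv (ha : 0 < a) (hx : x ∈ Ioo (0 : ℝ) 1) :
    HasDerivAt (secondDeriv a) (thirdDeriv a x) x := by
  have hu := sub_ne_zero.2 (rpow_mem_Ioo ha hx).2.ne'
  have h := hasDerivAt_rpow (a := a) hx.1
  have hx0 := hx.1.ne'
  have h1 := h.const_sub 1
  have h2 := (h.const_add 1).const_mul (a ^ 2)
  refine HasDerivAt.congr_deriv ((h.mul ((h2.sub (h1.const_mul a)).sub ((hasDerivAt_pow 2 x).mul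
      ((h2.add (h1.const_mul (3 * a))).add ((h1.pow 2).const_mul 2))))).div
    ((hasDerivAt_pow 2 x).mul (h1.pow 3))
    (mul_ne_zero (pow_ne_zero 2 hx0) (pow_ne_zero 3 hu))) ?_
  simp only [thirdDeriv, polyP, polyQ, Pi.mul_apply, Pi.pow_apply, Pi.add_apply, Pi.sub_apply]
  generalize x ^ a = u at *
  field_simp
  push_cast
  ring

lemma hasDerivAt_ratio (ha : 0 < a) (hx0 : 0 < x) (hx1 : x ≤ 1) :
    HasDerivAt (ratio a)
      (-2 * (a ^ 2 - 1) * (a ^ 2 - 4) * (1 - x ^ a) ^ 4 / (x ^ 3 * polyQ a (x ^ a) ^ 2)) x := by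
  have hq := (polyQ_pos ha (Real.rpow_nonneg hx0.le a) (Real.rpow_le_one hx0.le hx1 ha.le)).ne'
  have h := hasDerivAt_rpow (a := a) hx0
  have hx := hx0.ne'
  have h1 := ((((h.const_mul 4).const_add 1).add (h.pow 2)).const_mul (a ^ 2))
  have h2 := ((h.pow 2).const_sub 1).const_mul (3 * a)
  have h3 := ((h.const_sub 1).pow 2).const_mul 2
  refine HasDerivAt.congr_deriv (((h1.sub h2).add h3).div ((hasDerivAt_pow 2 x).mul ((h1.add h2).add h3))
    (mul_ne_zero (pow_ne_zero 2 hx) hq)) ?_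
  simp only [polyQ, Pi.pow_apply, Pi.add_apply, Pi.sub_apply] at hq ⊢
  generalize x ^ a = u at *
  field_simp
  push_cast
  ring

lemma ratio_one (ha : 0 < a) : ratio a 1 = 1 := by
  have := ha.ne'
  simp only [ratio, polyP, polyQ, Real.one_rpow]
  field_simp
  ring

lemma exists_ratio_sub_one (ha : 0 < a) (hx : x ∈ Ioo (0 : ℝ) 1) :
    ∃ c ∈ Ioo x 1, ratio a x - 1 = 2 * (a ^ 2 - 1) * (a ^ 2 - 4) * (1 - c ^ a) ^ 4 /
      (c ^ 3 * polyQ a (c ^ a) ^ 2) * (1 - x) := by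
  obtain ⟨c, hc, h⟩ := exists_hasDerivAt_eq_slope (ratio a) _ hx.2
    (fun y hy => (hasDerivAt_ratio ha (hx.1.trans_le hy.1) hy.2).continuousAt.continuousWithinAt)
    (fun y hy => hasDerivAt_ratio ha (hx.1.trans hy.1) hy.2.le)
  refine ⟨c, hc, ?_⟩
  rw [ratio_one ha, eq_div_iff (sub_pos.2 hx.2).ne'] at h
  rw [← neg_sub, ← h]
  ring

lemma thirdDeriv_eq (ha : 0 < a) (hx : x ∈ Ioo (0 : ℝ) 1) :
    thirdDeriv a x =
      a * x ^ a * polyQ a (x ^ a) / (x * (1 - x ^ a) ^ 4) * (ratio a x - 1) := by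
  have hu := rpow_mem_Ioo ha hx
  have hq := (polyQ_pos ha hu.1.le hu.2.le).ne'
  have hu' := sub_ne_zero.2 hu.2.ne'
  have := hx.1.ne'
  unfold thirdDeriv ratio
  field_simp

lemma exists_thirdDeriv_eq (ha : 0 < a) (hx : x ∈ Ioo (0 : ℝ) 1) :
    ∃ K : ℝ, 0 < K ∧ thirdDeriv a x = K * ((a ^ 2 - 1) * (a ^ 2 - 4)) := by
  obtain ⟨c, hc, h⟩ := exists_ratio_sub_one ha hx
  have hc' : c ∈ Ioo (0 : ℝ) 1 := ⟨hx.1.trans hc.1, hc.2⟩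
  have hu := rpow_mem_Ioo ha hx
  have hv := rpow_mem_Ioo ha hc'
  have := polyQ_pos ha hu.1.le hu.2.le
  have := polyQ_pos ha hv.1.le hv.2.le
  have := sub_pos.2 hu.2
  have := sub_pos.2 hv.2
  have := sub_pos.2 hx.2
  have := hx.1
  have := hc'.1
  have := hu.1
  refine ⟨a * x ^ a * polyQ a (x ^ a) / (x * (1 - x ^ a) ^ 4) *
    (2 * (1 - c ^ a) ^ 4 / (c ^ 3 * polyQ a (c ^ a) ^ 2) * (1 - x)), by positivity, ?_⟩
  rw [thirdDeriv_eq ha hx, h]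
  ring

lemma abs_thirdDeriv_le (ha : 0 < a) (hx : x ∈ Ioo (0 : ℝ) 1) :
    |thirdDeriv a x| ≤ 2 * |(a ^ 2 - 1) * (a ^ 2 - 4)| * x ^ a * polyQ a (x ^ a) * (1 - x) /
      (a ^ 3 * x ^ 4) := by
  obtain ⟨c, hc, h⟩ := exists_ratio_sub_one ha hx
  have hc' : c ∈ Ioo (0 : ℝ) 1 := ⟨hx.1.trans hc.1, hc.2⟩
  have hu := rpow_mem_Ioo ha hx
  have hv := rpow_mem_Ioo ha hc'
  have hQ := polyQ_pos ha hu.1.le hu.2.le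
  have hQc := sq_le_polyQ ha hv.1.le hv.2.le
  have hu1 := sub_pos.2 hu.2
  have hv1 := sub_pos.2 hv.2
  have hx1 := sub_pos.2 hx.2
  have hx0 := hx.1
  have hc0 := hc'.1
  have hu0 := hu.1
  have hvu : 1 - c ^ a ≤ 1 - x ^ a :=
    sub_le_sub_left (Real.rpow_le_rpow hx0.le hc.1.le ha.le) 1
  have hfrac : (1 - c ^ a) ^ 4 / (c ^ 3 * polyQ a (c ^ a) ^ 2) ≤
      (1 - x ^ a) ^ 4 / (x ^ 3 * (a ^ 2) ^ 2) := by
    have := hc.1.le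
    gcongr
  have hfrac0 : 0 ≤ (1 - c ^ a) ^ 4 / (c ^ 3 * polyQ a (c ^ a) ^ 2) := by positivity
  have hK : 0 ≤ 2 * a * x ^ a * polyQ a (x ^ a) / (x * (1 - x ^ a) ^ 4) * (1 - x) := by
    positivity
  have key : thirdDeriv a x = ((a ^ 2 - 1) * (a ^ 2 - 4)) *
      (2 * a * x ^ a * polyQ a (x ^ a) / (x * (1 - x ^ a) ^ 4) * (1 - x) *
        ((1 - c ^ a) ^ 4 / (c ^ 3 * polyQ a (c ^ a) ^ 2))) := by
    rw [thirdDeriv_eq ha hx, h]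
    ring
  rw [key, abs_mul, abs_of_nonneg (mul_nonneg hK hfrac0)]
  refine (mul_le_mul_of_nonneg_left (mul_le_mul_of_nonneg_left hfrac hK) (abs_nonneg _)).trans_eq ?_
  field_simp

lemma Ioo_mem_nhdsLT_one : Ioo (0 : ℝ) 1 ∈ 𝓝[<] (1 : ℝ) := Ioo_mem_nhdsLT one_pos

lemma tendsto_rpow_one : Tendsto (fun x : ℝ => x ^ a) (𝓝[<] (1 : ℝ)) (𝓝 1) := by
  have h : ContinuousAt (fun x : ℝ => x ^ a) 1 := (hasDerivAt_rpow one_pos).continuousAt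
  simpa using h.tendsto.mono_left nhdsWithin_le_nhds

lemma tendsto_id_one : Tendsto (fun x : ℝ => x) (𝓝[<] (1 : ℝ)) (𝓝 1) :=
  tendsto_id.mono_left nhdsWithin_le_nhds

lemma tendsto_thirdDeriv (ha : 0 < a) : Tendsto (thirdDeriv a) (𝓝[<] (1 : ℝ)) (𝓝 0) := by
  refine squeeze_zero_norm' (mem_of_superset Ioo_mem_nhdsLT_one fun x hx =>
    abs_thirdDeriv_le ha hx) ?_
  have hQ : Tendsto (fun x : ℝ => polyQ a (x ^ a)) (𝓝[<] (1 : ℝ)) (𝓝 (polyQ a 1)) := by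
    have : Continuous (polyQ a) := by unfold polyQ; fun_prop
    exact this.continuousAt.tendsto.comp tendsto_rpow_one
  have h := ((((tendsto_rpow_one (a := a)).const_mul
    (2 * |(a ^ 2 - 1) * (a ^ 2 - 4)|)).mul hQ).mul (tendsto_id_one.const_sub 1)).div
    ((tendsto_id_one.pow 4).const_mul (a ^ 3)) (by positivity)
  simpa [Pi.div_def] using h

lemma firstNumer_pos (ha : 0 < a) (hx : x ∈ Ioo (0 : ℝ) 1) : 0 < firstNumer a x := by
  have hanti : StrictAntiOn (firstNumer a) (Icc x 1) := by
    refine strictAntiOn_of_deriv_neg (convex_Icc x 1) (fun y hy =>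
      (hasDerivAt_firstNumer (hx.1.trans_le hy.1)).continuousAt.continuousWithinAt) fun y hy => ?_
    rw [interior_Icc] at hy
    have hy' : y ∈ Ioo (0 : ℝ) 1 := ⟨hx.1.trans hy.1, hy.2⟩
    rw [(hasDerivAt_firstNumer hy'.1).deriv]
    have h1 := sub_pos.2 (rpow_mem_Ioo ha hy').2
    have h2 := hy'.1
    have h3 : 0 < 2 * (a + 2) * y * (1 - y ^ a) := by positivity
    linarith
  have h := hanti (left_mem_Icc.2 hx.2.le) (right_mem_Icc.2 hx.2.le) hx.2
  simpa [firstNumer] using h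

lemma firstDeriv_pos (ha : 0 < a) (hx : x ∈ Ioo (0 : ℝ) 1) : 0 < firstDeriv a x := by
  have hu := rpow_mem_Ioo ha hx
  exact div_pos (mul_pos hu.1 (firstNumer_pos ha hx))
    (mul_pos hx.1 (pow_pos (sub_pos.2 hu.2) 2))

lemma tendsto_base (ha : 0 < a) :
    Tendsto (fun x : ℝ => x ^ a * (1 - x ^ 2) / (1 - x ^ a)) (𝓝[<] (1 : ℝ)) (𝓝 (2 / a)) := by
  have hquot : Tendsto (fun x : ℝ => (1 - x ^ 2) / (1 - x ^ a)) (𝓝[<] (1 : ℝ)) (𝓝 (2 / a)) := by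
    refine HasDerivAt.lhopital_zero_nhdsLT
      (f' := fun x => -(2 * x)) (g' := fun x : ℝ => -(a * x ^ a / x)) ?_ ?_ ?_ ?_ ?_ ?_
    · exact Eventually.of_forall fun x => by simpa using (hasDerivAt_pow 2 x).const_sub 1
    · exact mem_of_superset Ioo_mem_nhdsLT_one fun x hx => (hasDerivAt_rpow hx.1).const_sub 1
    · refine mem_of_superset Ioo_mem_nhdsLT_one fun x hx => ?_
      have := hx.1
      exact neg_ne_zero.2 (by positivity)
    · simpa using (tendsto_id_one.pow 2).const_sub 1
    · simpa using (tendsto_rpow_one (a := a)).const_sub 1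
    · have h := (tendsto_id_one.const_mul 2).neg.div
        (((tendsto_rpow_one (a := a)).const_mul a).div tendsto_id_one one_ne_zero).neg
        (by simpa using ha.ne')
      simpa [Pi.div_def, neg_div_neg_eq] using h
  simpa [mul_div_assoc] using (tendsto_rpow_one (a := a)).mul hquot

lemma tendsto_firstDeriv (ha : 0 < a) :
    Tendsto (firstDeriv a) (𝓝[<] (1 : ℝ)) (𝓝 ((a + 2) / a)) := by
  have hquot : Tendsto (fun x : ℝ => firstNumer a x / (1 - x ^ a) ^ 2) (𝓝[<] (1 : ℝ))
      (𝓝 ((a + 2) / a)) := by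
    refine HasDerivAt.lhopital_zero_nhdsLT
      (f' := fun x => -2 * (a + 2) * x * (1 - x ^ a))
      (g' := fun x : ℝ => 2 * (1 - x ^ a) * -(a * x ^ a / x)) ?_ ?_ ?_ ?_ ?_ ?_
    · exact mem_of_superset Ioo_mem_nhdsLT_one fun x hx => hasDerivAt_firstNumer hx.1
    · exact mem_of_superset Ioo_mem_nhdsLT_one fun x hx => by
        simpa using ((hasDerivAt_rpow (a := a) hx.1).const_sub 1).fun_pow 2
    · refine mem_of_superset Ioo_mem_nhdsLT_one fun x hx => ?_
      have := hx.1
      have := sub_pos.2 (rpow_mem_Ioo ha hx).2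
      exact mul_ne_zero (by positivity) (neg_ne_zero.2 (by positivity))
    · have h : Tendsto (firstNumer a) (𝓝[<] (1 : ℝ)) (𝓝 (firstNumer a 1)) :=
        (hasDerivAt_firstNumer one_pos).continuousAt.tendsto.mono_left nhdsWithin_le_nhds
      simpa [firstNumer] using h
    · simpa using ((tendsto_rpow_one (a := a)).const_sub 1).pow 2
    · have h := ((tendsto_id_one.pow 2).const_mul (a + 2)).div
        ((tendsto_rpow_one (a := a)).const_mul a) (by simpa using ha.ne')
      simp only [one_pow, mul_one] at h
      refine h.congr' (mem_of_superset Ioo_mem_nhdsLT_one fun x hx => ?_)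
      have hu := sub_ne_zero.2 (rpow_mem_Ioo ha hx).2.ne'
      have hu0 := (rpow_mem_Ioo ha hx).1.ne'
      have := hx.1.ne'
      simp only [Pi.div_apply, mem_ofPred_eq]
      field_simp
  have h := (((tendsto_rpow_one (a := a)).div tendsto_id_one one_ne_zero).mul hquot)
  simp only [div_one, one_mul] at h
  refine h.congr fun x => ?_
  simp only [firstDeriv, Pi.div_apply]
  rw [div_mul_div_comm]

lemma eqOn_deriv {f g f' : ℝ → ℝ} {s : Set ℝ} (hs : IsOpen s) (hfg : EqOn f g s)
    (hg : ∀ y ∈ s, HasDerivAt g (f' y) y) : EqOn (deriv f) f' s := fun y hy =>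
  ((hg y hy).congr_of_eventuallyEq (hfg.eventuallyEq_of_mem (hs.mem_nhds hy))).deriv

end Bd

/-- Properties of the function `B_d(ρ) = ρ^{2D}(1-ρ²)/(1-ρ^{2D})`, `D = (d-2)/2 > 0`:
positivity and strict monotonicity on `(0,1)`, the limits of `B_d`, `B_d'`, `B_d' ' '`
at `1⁻`, the sign of the third derivative, and the formula for `B_d'/B_d`. -/
theorem Bd_properties (D : ℝ) (hD : 0 < D) (B : ℝ → ℝ)
    (hB : ∀ ρ : ℝ, B ρ = ρ ^ (2 * D) * (1 - ρ ^ 2) / (1 - ρ ^ (2 * D))) :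
    (∀ ρ ∈ Ioo (0 : ℝ) 1, 0 < B ρ) ∧
    StrictMonoOn B (Ioo (0 : ℝ) 1) ∧
    Tendsto B (𝓝[<] (1 : ℝ)) (𝓝 (1 / D)) ∧
    Tendsto (deriv B) (𝓝[<] (1 : ℝ)) (𝓝 ((D + 1) / D)) ∧
    Tendsto (deriv (deriv (deriv B))) (𝓝[<] (1 : ℝ)) (𝓝 0) ∧
    (1 < D → ∀ ρ ∈ Ioo (0 : ℝ) 1, 0 < deriv (deriv (deriv B)) ρ) ∧
    (1 / 2 < D → D < 1 → ∀ ρ ∈ Ioo (0 : ℝ) 1, deriv (deriv (deriv B)) ρ < 0) ∧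
    (∀ ρ ∈ Ioo (0 : ℝ) 1, deriv B ρ / B ρ =
      2 * (D - ρ ^ 2 + ρ ^ (2 * D + 2) - ρ ^ 2 * D) /
        (ρ * (1 - ρ ^ (2 * D)) * (1 - ρ ^ 2))) := by
  have ha : 0 < 2 * D := by positivity
  have hBfun : B = fun y : ℝ => y ^ (2 * D) * (1 - y ^ 2) / (1 - y ^ (2 * D)) := funext hB
  have h1 : EqOn (deriv B) (Bd.firstDeriv (2 * D)) (Ioo 0 1) :=
    Bd.eqOn_deriv isOpen_Ioo (fun y _ => hB y) fun y hy => Bd.hasDerivAt_base ha hy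
  have h2 : EqOn (deriv (deriv B)) (Bd.secondDeriv (2 * D)) (Ioo 0 1) :=
    Bd.eqOn_deriv isOpen_Ioo h1 fun y hy => Bd.hasDerivAt_firstDeriv ha hy
  have h3 : EqOn (deriv (deriv (deriv B))) (Bd.thirdDeriv (2 * D)) (Ioo 0 1) :=
    Bd.eqOn_deriv isOpen_Ioo h2 fun y hy => Bd.hasDerivAt_secondDeriv ha hy
  refine ⟨fun ρ hρ => ?_, ?_, ?_, ?_, ?_, fun hD1 ρ hρ => ?_, fun hD1 hD2 ρ hρ => ?_,
    fun ρ hρ => ?_⟩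
  · have hu := Bd.rpow_mem_Ioo ha hρ
    rw [hB]
    exact div_pos (mul_pos hu.1 (sub_pos.2 (pow_lt_one₀ hρ.1.le hρ.2 two_ne_zero)))
      (sub_pos.2 hu.2)
  · refine strictMonoOn_of_deriv_pos (convex_Ioo 0 1) (fun y hy => ?_) fun y hy => ?_
    · rw [hBfun]
      exact (Bd.hasDerivAt_base ha hy).continuousAt.continuousWithinAt
    · rw [interior_Ioo] at hy
      rw [h1 hy]
      exact Bd.firstDeriv_pos ha hy
  · rw [hBfun]
    convert Bd.tendsto_base ha using 2
    field_simp
  · have h := Bd.tendsto_firstDeriv ha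
    rw [show (2 * D + 2) / (2 * D) = (D + 1) / D by field_simp] at h
    exact h.congr' (h1.symm.eventuallyEq_of_mem Bd.Ioo_mem_nhdsLT_one)
  · exact (Bd.tendsto_thirdDeriv ha).congr' (h3.symm.eventuallyEq_of_mem Bd.Ioo_mem_nhdsLT_one)
  · obtain ⟨K, hK, h⟩ := Bd.exists_thirdDeriv_eq ha hρ
    rw [h3 hρ, h]
    exact mul_pos hK (mul_pos (by nlinarith) (by nlinarith))
  · obtain ⟨K, hK, h⟩ := Bd.exists_thirdDeriv_eq ha hρ
    rw [h3 hρ, h]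
    exact mul_neg_of_pos_of_neg hK (mul_neg_of_pos_of_neg (by nlinarith) (by nlinarith))
  · have hu := Bd.rpow_mem_Ioo ha hρ
    have hu1 := sub_ne_zero.2 hu.2.ne'
    have hu0 := hu.1.ne'
    have hρ0 := hρ.1.ne'
    have hρ1 : 1 - ρ ^ 2 ≠ 0 := (sub_pos.2 (pow_lt_one₀ hρ.1.le hρ.2 two_ne_zero)).ne'
    have hpow : ρ ^ (2 * D + 2) = ρ ^ (2 * D) * ρ ^ 2 := by
      rw [Real.rpow_add hρ.1, Real.rpow_two]
    rw [h1 hρ, hB, hpow, Bd.firstDeriv, Bd.firstNumer]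
    generalize ρ ^ (2 * D) = u at *
    field_simp
    ring
end
end
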